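/- arXiv:1801.03217 — 4 statements merged into one kernel-verified Lean document; each statement's English description precedes it below -/
import Mathlib

section
/- For a critical Galton-Watson process with E[ξ] = 1 and Var(ξ) = 2B ∈ (0,∞), for every y ≥ 0, lim_{n→∞} P(Z(n)/(Bn) ≤ y | Z(n) > 0) = 1 - e^{-y} (Yaglom's exponential limit law). -/
open MeasureTheory Filter Topology Asymptotics Real

/-- Probability generating function of the offspring distribution `p`. -/
noncomputable def pgf (p : ℕ → ℝ) (s : ℝ) : ℝ := ∑' k, p k * s ^ k

/-- `n`-th functional iterate of the offspring generating function. -/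
noncomputable def pgfIter (p : ℕ → ℝ) : ℕ → ℝ → ℝ
  | 0 => fun s => s
  | n + 1 => fun s => pgf p (pgfIter p n s)

noncomputable def cc (k : ℕ) (s : ℝ) : ℝ := ∑ j ∈ Finset.range k, ∑ i ∈ Finset.range j, s ^ i

lemma cc_id (k : ℕ) (s : ℝ) : s ^ k - 1 - k * (s - 1) = (1 - s) ^ 2 * cc k s := by
  have h1 : ∀ j : ℕ, (1 - s) * ∑ i ∈ Finset.range j, s ^ i = 1 - s ^ j := fun j => mul_neg_geom_sum s j
  have h2 : (1 - s) * cc k s = k - ∑ j ∈ Finset.range k, s ^ j := by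
    rw [cc, Finset.mul_sum]
    simp [h1]
  have h3 := h1 k
  calc s ^ k - 1 - k * (s - 1) = (1 - s) * k - (1 - s ^ k) := by ring
    _ = (1 - s) * (k - ∑ j ∈ Finset.range k, s ^ j) := by rw [← h3]; ring
    _ = _ := by rw [← h2]; ring

lemma cc_nonneg (k : ℕ) {s : ℝ} (hs : 0 ≤ s) : 0 ≤ cc k s :=
  Finset.sum_nonneg fun _ _ => Finset.sum_nonneg fun _ _ => pow_nonneg hs _

lemma cc_one (k : ℕ) : cc k 1 = ((k : ℝ) ^ 2 - k) / 2 := by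
  simp only [cc, one_pow, Finset.sum_const, Finset.card_range, nsmul_eq_mul, mul_one]
  induction k with
  | zero => simp
  | succ n ih => rw [Finset.sum_range_succ, ih]; push_cast; ring

lemma cc_le (k : ℕ) {s : ℝ} (hs : 0 ≤ s) (hs1 : s ≤ 1) : cc k s ≤ (k : ℝ) ^ 2 := by
  have : cc k s ≤ cc k 1 := Finset.sum_le_sum fun _ _ => Finset.sum_le_sum fun _ _ => by
    gcongr
  rw [cc_one] at this
  have : (0 : ℝ) ≤ k := by positivity
  nlinarith

lemma cc_pos {k : ℕ} (hk : 2 ≤ k) {s : ℝ} (hs : 0 ≤ s) : 0 < cc k s := by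
  have h0 : ∑ i ∈ Finset.range 1, s ^ i ≤ cc k s :=
    Finset.single_le_sum (f := fun j => ∑ i ∈ Finset.range j, s ^ i)
      (fun _ _ => Finset.sum_nonneg fun _ _ => pow_nonneg hs _) (Finset.mem_range.2 (by omega))
  simp at h0
  linarith

noncomputable def gg (p : ℕ → ℝ) (s : ℝ) : ℝ := ∑' k, p k * cc k s

/-- step function -/
noncomputable def hh (p : ℕ → ℝ) (s : ℝ) : ℝ := gg p s / (1 - (1 - s) * gg p s)

/-- Standing facts about `f`. -/
lemma step_facts (p : ℕ → ℝ) (hp0 : ∀ k, 0 ≤ p k) (hp1 : ∑' k, p k = 1)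
    (hmean : ∑' k : ℕ, (k : ℝ) * p k = 1) (B : ℝ) (hB : 0 < B)
    (hsq : Summable fun k : ℕ => (k : ℝ) ^ 2 * p k)
    (hvar : (∑' k : ℕ, (k : ℝ) ^ 2 * p k) - 1 = 2 * B) :
    ContinuousOn (gg p) (Set.Icc 0 1) ∧ gg p 1 = B ∧ (∀ s ∈ Set.Icc (0:ℝ) 1, 0 < gg p s) ∧
    (∀ s ∈ Set.Icc (0:ℝ) 1, pgf p s = s + (1 - s) ^ 2 * gg p s) ∧
    (∀ s ∈ Set.Ico (0:ℝ) 1, pgf p s < 1) ∧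
    (∀ s ∈ Set.Icc (0:ℝ) 1, ∀ t ∈ Set.Icc (0:ℝ) 1, s ≤ t → pgf p s ≤ pgf p t) := by
  have sp : Summable p := by
    by_contra h; rw [tsum_eq_zero_of_not_summable h] at hp1; norm_num at hp1
  have sm : Summable fun k : ℕ => (k : ℝ) * p k := by
    by_contra h; rw [tsum_eq_zero_of_not_summable h] at hmean; norm_num at hmean
  have sf : ∀ s ∈ Set.Icc (0:ℝ) 1, Summable fun k => p k * s ^ k := fun s hs =>
    Summable.of_nonneg_of_le (fun k => mul_nonneg (hp0 k) (pow_nonneg hs.1 _))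
      (fun k => mul_le_of_le_one_right (hp0 k) (pow_le_one₀ hs.1 hs.2)) sp
  have sg : ∀ s ∈ Set.Icc (0:ℝ) 1, Summable fun k => p k * cc k s := fun s hs =>
    Summable.of_nonneg_of_le (fun k => mul_nonneg (hp0 k) (cc_nonneg k hs.1))
      (fun k => by rw [mul_comm]; exact mul_le_mul_of_nonneg_right (cc_le k hs.1 hs.2) (hp0 k)) hsq
  have g1 : gg p 1 = B := by
    have : gg p 1 = ((∑' k : ℕ, (k : ℝ) ^ 2 * p k) - ∑' k : ℕ, (k : ℝ) * p k) / 2 := by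
      rw [← hsq.tsum_sub sm, ← tsum_div_const, gg]
      exact tsum_congr fun k => by rw [cc_one]; ring
    rw [this, hmean]; linarith
  obtain ⟨m, hm2, hm⟩ : ∃ m, 2 ≤ m ∧ 0 < p m := by
    by_contra! hcon
    have : gg p 1 = 0 := by
      rw [gg]
      refine (tsum_congr fun k => ?_).trans tsum_zero
      by_cases hk : 2 ≤ k
      · rw [le_antisymm (hcon k hk) (hp0 k), zero_mul]
      · have : k = 0 ∨ k = 1 := by omega
        rcases this with rfl | rfl <;> simp [cc]
    linarith
  refine ⟨?_, g1, ?_, ?_, ?_, ?_⟩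
  · refine continuousOn_tsum (u := fun k : ℕ => (k : ℝ) ^ 2 * p k) (fun k => ?_) hsq ?_
    · unfold cc; fun_prop
    · intro k s hs
      rw [Real.norm_of_nonneg (mul_nonneg (hp0 k) (cc_nonneg k hs.1)), mul_comm]
      exact mul_le_mul_of_nonneg_right (cc_le k hs.1 hs.2) (hp0 k)
  · intro s hs
    exact (sg s hs).tsum_pos (fun k => mul_nonneg (hp0 k) (cc_nonneg k hs.1)) m
      (mul_pos hm (cc_pos hm2 hs.1))
  · intro s hs
    have h1 : ∑' k, (1 - s) ^ 2 * (p k * cc k s) = (1 - s) ^ 2 * gg p s := tsum_mul_left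
    have h2 : ∑' k : ℕ, (p k * s ^ k - p k - (k * p k) * (s - 1)) = pgf p s - 1 - 1 * (s - 1) := by
      rw [((sf s hs).sub sp).tsum_sub (sm.mul_right _), (sf s hs).tsum_sub sp, hp1, tsum_mul_right,
        hmean, pgf]
    have h3 : ∑' k : ℕ, (p k * s ^ k - p k - (k * p k) * (s - 1)) =
      ∑' k, (1 - s) ^ 2 * (p k * cc k s) := tsum_congr fun k => by
        have := cc_id k s
        linear_combination (p k) * this
    linarith
  · intro s hs
    have hs' : s ∈ Set.Icc (0:ℝ) 1 := ⟨hs.1, hs.2.le⟩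
    rw [← hp1]
    refine (sf s hs').tsum_lt_tsum (i := m)
      (fun k => mul_le_of_le_one_right (hp0 k) (pow_le_one₀ hs.1 hs.2.le)) ?_ sp
    exact mul_lt_of_lt_one_right hm (pow_lt_one₀ hs.1 hs.2 (by omega))
  · intro s hs t ht hst
    exact (sf s hs).tsum_le_tsum (fun k => mul_le_mul_of_nonneg_left
      (pow_le_pow_left₀ hs.1 hst k) (hp0 k)) (sf t ht)

lemma iter_asymp (p : ℕ → ℝ) (hp0 : ∀ k, 0 ≤ p k) (hp1 : ∑' k, p k = 1)
    (hmean : ∑' k : ℕ, (k : ℝ) * p k = 1) (B : ℝ) (hB : 0 < B)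
    (hsq : Summable fun k : ℕ => (k : ℝ) ^ 2 * p k)
    (hvar : (∑' k : ℕ, (k : ℝ) ^ 2 * p k) - 1 = 2 * B) :
    (∀ n, ∀ s ∈ Set.Ico (0:ℝ) 1, pgfIter p n s ∈ Set.Ico (0:ℝ) 1) ∧
    ∀ ε > 0, ∃ C, ∀ n : ℕ, ∀ s ∈ Set.Ico (0:ℝ) 1,
      |1 / (1 - pgfIter p n s) - 1 / (1 - s) - n * B| ≤ ε * n + C := by
  obtain ⟨gc, g1, gpos, fg, flt, fmono⟩ := step_facts p hp0 hp1 hmean B hB hsq hvar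
  have ico : ∀ {s : ℝ}, s ∈ Set.Ico (0:ℝ) 1 → s ∈ Set.Icc (0:ℝ) 1 := fun h => ⟨h.1, h.2.le⟩
  have fgt : ∀ s ∈ Set.Ico (0:ℝ) 1, s < pgf p s := fun s hs => by
    rw [fg s (ico hs)]
    have : 0 < 1 - s := by linarith [hs.2]
    have := gpos s (ico hs)
    have : 0 < (1 - s) ^ 2 * gg p s := by positivity
    linarith
  have hmem : ∀ n, ∀ s ∈ Set.Ico (0:ℝ) 1, pgfIter p n s ∈ Set.Ico (0:ℝ) 1 := by
    intro n s hs
    induction n with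
    | zero => exact hs
    | succ n ih => exact ⟨ih.1.trans (fgt _ ih).le, flt _ ih⟩
  have den : ∀ s ∈ Set.Icc (0:ℝ) 1, 0 < 1 - (1 - s) * gg p s := by
    intro s hs
    rcases hs.2.lt_or_eq with h | h
    · have h1 := flt s ⟨hs.1, h⟩
      rw [fg s hs] at h1
      have h2 : 0 < 1 - s := by linarith
      have h3 : 0 < (1 - s) * (1 - (1 - s) * gg p s) := by nlinarith
      exact pos_of_mul_pos_right h3 h2.le
    · subst h; simp
  have hc : ContinuousOn (hh p) (Set.Icc 0 1) :=
    gc.div (by fun_prop) fun s hs => (den s hs).ne'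
  have hh1 : hh p 1 = B := by simp [hh, g1]
  have hstep : ∀ s ∈ Set.Ico (0:ℝ) 1, 1 / (1 - pgf p s) - 1 / (1 - s) = hh p s := by
    intro s hs
    have h1 : (1 - s) ≠ 0 := by linarith [hs.2]
    have h2 := (den s (ico hs)).ne'
    have h3 : 1 - pgf p s = (1 - s) * (1 - (1 - s) * gg p s) := by rw [fg s (ico hs)]; ring
    rw [h3, hh]
    field_simp
    ring
  obtain ⟨M, hM⟩ := isCompact_Icc.exists_bound_of_continuousOn
    (hc.sub (continuousOn_const (c := B)))
  have hM0 : 0 ≤ M := (norm_nonneg _).trans (hM 0 (by simp))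
  -- monotonicity
  have hge : ∀ n, ∀ s ∈ Set.Ico (0:ℝ) 1, pgfIter p n 0 ≤ pgfIter p n s := by
    intro n s hs
    induction n with
    | zero => exact hs.1
    | succ n ih => exact fmono _ (ico (hmem n 0 (by simp))) _ (ico (hmem n s hs)) ih
  have hmono : Monotone fun n => pgfIter p n 0 :=
    monotone_nat_of_le_succ fun n => (fgt _ (hmem n 0 (by simp))).le
  have hlim : Tendsto (fun n => pgfIter p n 0) atTop (𝓝 1) := by
    have hb : BddAbove (Set.range fun n => pgfIter p n 0) :=
      ⟨1, by rintro _ ⟨n, rfl⟩; exact (hmem n 0 (by simp)).2.le⟩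
    have ht := tendsto_atTop_ciSup hmono hb
    set L := ⨆ n, pgfIter p n 0 with hL
    have hLm : L ∈ Set.Icc (0:ℝ) 1 :=
      isClosed_Icc.mem_of_tendsto ht (Eventually.of_forall fun n => ico (hmem n 0 (by simp)))
    have fc : ContinuousOn (pgf p) (Set.Icc 0 1) := by
      refine ContinuousOn.congr (f := fun s => s + (1 - s) ^ 2 * gg p s) (by fun_prop) fg
    have ht2 : Tendsto (fun n => pgf p (pgfIter p n 0)) atTop (𝓝 (pgf p L)) :=
      (fc L hLm).tendsto.comp (tendsto_nhdsWithin_iff.2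
        ⟨ht, Eventually.of_forall fun n => ico (hmem n 0 (by simp))⟩)
    have ht3 := ht.comp (tendsto_add_atTop_nat 1)
    have hfix : pgf p L = L := tendsto_nhds_unique ht2 ht3
    rcases hLm.2.lt_or_eq with h | h
    · exact absurd hfix (fgt L ⟨hLm.1, h⟩).ne'
    · rwa [h] at ht
  refine ⟨hmem, fun ε hε => ?_⟩
  obtain ⟨δ, hδ, hδ'⟩ := Metric.continuousOn_iff.1 hc 1 (by simp) ε hε
  obtain ⟨J, hJ⟩ := Metric.tendsto_atTop.1 hlim δ hδ
  refine ⟨M * J, fun n s hs => ?_⟩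
  have key : |1 / (1 - pgfIter p n s) - 1 / (1 - s) - n * B| ≤ ε * n + M * (min n J : ℕ) := by
    induction n with
    | zero => simp [pgfIter]
    | succ n ih =>
      have hm := hmem n s hs
      have h1 : 1 / (1 - pgfIter p (n+1) s) = 1 / (1 - pgfIter p n s) + hh p (pgfIter p n s) := by
        rw [← hstep _ hm]; simp only [pgfIter]; ring
      have h2 : 1 / (1 - pgfIter p (n+1) s) - 1 / (1 - s) - ((n+1 : ℕ) : ℝ) * B =
        (1 / (1 - pgfIter p n s) - 1 / (1 - s) - n * B) + (hh p (pgfIter p n s) - B) := by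
        rw [h1]; push_cast; ring
      rw [h2]
      refine (abs_add_le _ _).trans ?_
      by_cases hnJ : n < J
      · have h3 := hM _ (ico hm)
        rw [Real.norm_eq_abs] at h3
        change |hh p (pgfIter p n s) - B| ≤ M at h3
        have e1 : min (n+1) J = n + 1 := by omega
        have e2 : min n J = n := by omega
        rw [e1]; rw [e2] at ih
        push_cast
        linarith
      · have h4 := hJ n (by omega)
        have h5 := hge n s hs
        have h3 := hδ' _ (ico hm) (by
          rw [Real.dist_eq, abs_lt] at h4 ⊢
          have := hm.2
          constructor <;> linarith)
        rw [hh1, Real.dist_eq] at h3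
        have e1 : min (n+1) J = J := by omega
        have e2 : min n J = J := by omega
        rw [e1]; rw [e2] at ih
        push_cast
        linarith
  refine key.trans ?_
  gcongr
  exact min_le_right _ _

lemma unif_lim {Ω : Type*} [MeasurableSpace Ω] (ν : ℕ → Measure Ω)
    (hν : ∀ n, IsProbabilityMeasure (ν n)) (W : ℕ → Ω → ℝ) (hW : ∀ n, Measurable (W n))
    (hW1 : ∀ n ω, W n ω ∈ Set.Icc (0:ℝ) 1)
    (h : ∀ k : ℕ, Tendsto (fun n => ∫ ω, W n ω ^ k ∂(ν n)) atTop (𝓝 (1 / ((k:ℝ) + 1))))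
    (t : ℝ) (ht : t ∈ Set.Icc (0:ℝ) 1) :
    Tendsto (fun n => (ν n).real {ω | t ≤ W n ω}) atTop (𝓝 (1 - t)) := by
  let U : Measure ℝ := volume.restrict (Set.Icc 0 1)
  have hU : IsProbabilityMeasure U := ⟨by simp [U]⟩
  let P : ℕ → ProbabilityMeasure ℝ := fun n =>
    ⟨(ν n).map (W n), Measure.isProbabilityMeasure_map (hW n).aemeasurable⟩
  let Q : ProbabilityMeasure ℝ := ⟨U, hU⟩
  have hint : ∀ n (f : ℝ → ℝ), Continuous f → ∫ x, f x ∂(P n : Measure ℝ) = ∫ ω, f (W n ω) ∂(ν n) :=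
    fun n f hf => integral_map (hW n).aemeasurable hf.aestronglyMeasurable
  have hPae : ∀ n, ∀ᵐ x ∂(P n : Measure ℝ), x ∈ Set.Icc (0:ℝ) 1 := fun n => by
    change ∀ᵐ x ∂((ν n).map (W n)), x ∈ Set.Icc (0:ℝ) 1
    exact (ae_map_iff (p := fun x => x ∈ Set.Icc (0:ℝ) 1) (hW n).aemeasurable measurableSet_Icc).2
      (Eventually.of_forall (hW1 n))
  have hQae : ∀ᵐ x ∂(Q : Measure ℝ), x ∈ Set.Icc (0:ℝ) 1 := ae_restrict_mem measurableSet_Icc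
  have hI : ∀ (R : ProbabilityMeasure ℝ), (∀ᵐ x ∂(R : Measure ℝ), x ∈ Set.Icc (0:ℝ) 1) →
      ∀ f : ℝ → ℝ, Continuous f → Integrable f (R : Measure ℝ) := by
    intro R hR f hf
    obtain ⟨C, hC⟩ := isCompact_Icc.exists_bound_of_continuousOn (s := Set.Icc (0:ℝ) 1) hf.continuousOn
    refine Integrable.of_bound hf.aestronglyMeasurable C ?_
    filter_upwards [hR] with x hx using hC x hx
  have hpow : ∀ k : ℕ, Tendsto (fun n => ∫ x, x ^ k ∂(P n : Measure ℝ)) atTop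
      (𝓝 (∫ x, x ^ k ∂(Q : Measure ℝ))) := by
    intro k
    have e : ∫ x, x ^ k ∂(Q : Measure ℝ) = 1 / ((k:ℝ) + 1) := by
      change ∫ x in Set.Icc (0:ℝ) 1, x ^ k = _
      rw [integral_Icc_eq_integral_Ioc, ← intervalIntegral.integral_of_le zero_le_one,
        integral_pow]
      simp
    rw [e]
    refine (h k).congr fun n => (hint n _ (continuous_pow k)).symm
  have hpoly : ∀ q : Polynomial ℝ, Tendsto (fun n => ∫ x, q.eval x ∂(P n : Measure ℝ)) atTop
      (𝓝 (∫ x, q.eval x ∂(Q : Measure ℝ))) := by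
    intro q
    have e : ∀ R : ProbabilityMeasure ℝ, (∀ᵐ x ∂(R : Measure ℝ), x ∈ Set.Icc (0:ℝ) 1) →
        ∫ x, q.eval x ∂(R : Measure ℝ) =
          ∑ i ∈ Finset.range (q.natDegree + 1), q.coeff i * ∫ x, x ^ i ∂(R : Measure ℝ) := by
      intro R hR
      simp_rw [Polynomial.eval_eq_sum_range]
      rw [integral_finsetSum]
      · simp_rw [integral_const_mul]
      · intro i _
        exact hI R hR _ (by fun_prop)
    rw [e Q hQae]
    simp_rw [fun n => e (P n) (hPae n)]
    exact tendsto_finsetSum _ fun i _ => (hpow i).const_mul _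
  have hweak : Tendsto P atTop (𝓝 Q) := by
    rw [ProbabilityMeasure.tendsto_iff_forall_integral_tendsto]
    intro f
    rw [Metric.tendsto_atTop]
    intro ε hε
    obtain ⟨q, hq⟩ := exists_polynomial_near_of_continuousOn 0 1 f f.continuous.continuousOn
      (ε / 3) (by positivity)
    have hd : ∀ R : ProbabilityMeasure ℝ, (∀ᵐ x ∂(R : Measure ℝ), x ∈ Set.Icc (0:ℝ) 1) →
        |∫ x, q.eval x ∂(R : Measure ℝ) - ∫ x, f x ∂(R : Measure ℝ)| ≤ ε / 3 := by
      intro R hR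
      rw [← integral_sub (hI R hR _ q.continuous) (hI R hR _ f.continuous), ← Real.norm_eq_abs]
      refine (norm_integral_le_of_norm_le_const (C := ε / 3) ?_).trans (by simp)
      filter_upwards [hR] with x hx using (hq x hx).le
    obtain ⟨N, hN⟩ := Metric.tendsto_atTop.1 (hpoly q) (ε / 3) (by positivity)
    refine ⟨N, fun n hn => ?_⟩
    have h1 := hN n hn
    have h2 := hd (P n) (hPae n)
    have h3 := hd Q hQae
    rw [Real.dist_eq] at h1 ⊢
    rw [abs_le] at h2 h3
    rw [abs_lt] at h1 ⊢
    constructor <;> linarith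
  have hfr : (Q : Measure ℝ) (frontier (Set.Ici t)) = 0 := by
    rw [frontier_Ici]
    change (volume.restrict (Set.Icc (0:ℝ) 1)) {t} = 0
    exact measure_singleton t
  have hfin := ProbabilityMeasure.tendsto_measure_of_null_frontier_of_tendsto' hweak hfr
  have hfin2 := (ENNReal.tendsto_toReal (measure_ne_top _ _)).comp hfin
  have e1 : ((Q : Measure ℝ) (Set.Ici t)).toReal = 1 - t := by
    change ((volume.restrict (Set.Icc (0:ℝ) 1)) (Set.Ici t)).toReal = 1 - t
    rw [Measure.restrict_apply measurableSet_Ici]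
    have : Set.Ici t ∩ Set.Icc 0 1 = Set.Icc t 1 := by
      ext x; simp only [Set.mem_inter_iff, Set.mem_Ici, Set.mem_Icc]
      constructor
      · rintro ⟨a, b, c⟩; exact ⟨a, c⟩
      · rintro ⟨a, c⟩; exact ⟨a, ht.1.trans a, c⟩
    rw [this, Real.volume_Icc, ENNReal.toReal_ofReal (by linarith [ht.2])]
  rw [e1] at hfin2
  refine hfin2.congr fun n => ?_
  change (((ν n).map (W n)) (Set.Ici t)).toReal = _
  rw [Measure.map_apply (hW n) measurableSet_Ici]
  rfl

theorem yaglom_exponential_limit    (p : ℕ → ℝ) (hp0 : ∀ k, 0 ≤ p k) (hp1 : ∑' k, p k = 1)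
    (hmean : ∑' k : ℕ, (k : ℝ) * p k = 1) (B : ℝ) (hB : 0 < B)
    (hsq : Summable fun k : ℕ => (k : ℝ) ^ 2 * p k)
    (hvar : (∑' k : ℕ, (k : ℝ) ^ 2 * p k) - 1 = 2 * B)
    {Ω : Type*} [MeasurableSpace Ω] (μ : Measure Ω) [IsProbabilityMeasure μ]
    (Z : ℕ → Ω → ℕ) (hZm : ∀ n, Measurable (Z n))
    (hZ : ∀ n, ∀ s ∈ Set.Icc (0 : ℝ) 1, ∫ ω, s ^ Z n ω ∂μ = pgfIter p n s) :
    ∀ y : ℝ, 0 ≤ y →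
      Tendsto (fun n : ℕ =>
          (μ {ω | 0 < Z n ω ∧ (Z n ω : ℝ) ≤ B * n * y}).toReal /
            (μ {ω | 0 < Z n ω}).toReal)
        atTop (𝓝 (1 - Real.exp (-y))) := by
  intro y hy
  obtain ⟨hmem, hasy⟩ := iter_asymp p hp0 hp1 hmean B hB hsq hvar
  have hlimS : ∀ s : ℕ → ℝ, (∀ᶠ n in atTop, s n ∈ Set.Ico (0:ℝ) 1) →
      Tendsto (fun n : ℕ => (1 / (1 - pgfIter p n (s n)) - 1 / (1 - s n)) / n) atTop (𝓝 B) := by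
    intro s hs
    rw [Metric.tendsto_atTop]
    intro ε hε
    obtain ⟨C, hC⟩ := hasy (ε / 2) (by positivity)
    have h1 : Tendsto (fun n : ℕ => C / (n:ℝ)) atTop (𝓝 0) := tendsto_const_div_atTop_nhds_zero_nat C
    have h2 : ∀ᶠ n : ℕ in atTop, C / (n:ℝ) < ε / 2 := h1.eventually_lt_const (by positivity)
    obtain ⟨N, hN⟩ := eventually_atTop.1 (hs.and (h2.and (eventually_gt_atTop 0)))
    refine ⟨N, fun n hn => ?_⟩
    obtain ⟨hs, h2, hn0⟩ := hN n hn
    have hn' : (0:ℝ) < n := by exact_mod_cast hn0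
    have h3 := hC n (s n) hs
    rw [Real.dist_eq]
    have e : (1 / (1 - pgfIter p n (s n)) - 1 / (1 - s n)) / n - B =
      (1 / (1 - pgfIter p n (s n)) - 1 / (1 - s n) - n * B) / n := by field_simp
    rw [e, abs_div, abs_of_pos hn', div_lt_iff₀ hn']
    rw [div_lt_iff₀ hn'] at h2
    linarith
  have hlim0 : Tendsto (fun n : ℕ => (1 / (1 - pgfIter p n 0)) / n) atTop (𝓝 B) := by
    have h1 := (hlimS (fun _ => 0) (Eventually.of_forall fun _ => by simp)).add
      (tendsto_const_div_atTop_nhds_zero_nat (1:ℝ))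
    rw [add_zero] at h1
    refine h1.congr fun n => ?_
    ring
  -- the Laplace asymptotics
  have hlap : ∀ k : ℕ, 0 < k → Tendsto (fun n : ℕ =>
      (1 - pgfIter p n (Real.exp (-(k / (B * n))))) / (1 - pgfIter p n 0)) atTop
      (𝓝 (k / (k + 1))) := by
    intro k hk
    have hk' : (0:ℝ) < k := by exact_mod_cast hk
    have hs : ∀ᶠ n : ℕ in atTop, Real.exp (-(k / (B * n))) ∈ Set.Ico (0:ℝ) 1 := by
      filter_upwards [eventually_gt_atTop 0] with n hn
      have hn' : (0:ℝ) < n := by exact_mod_cast hn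
      refine ⟨(Real.exp_pos _).le, ?_⟩
      rw [Real.exp_lt_one_iff]
      have : 0 < k / (B * n) := by positivity
      linarith
    have h1 := hlimS _ hs
    have hd : HasDerivAt (fun t : ℝ => Real.exp (-(k / B) * t)) (-(k / B)) 0 := by
      have := ((hasDerivAt_id (0:ℝ)).const_mul (-(k / B))).exp
      simpa using this
    have h2 := hd.tendsto_slope_zero
    have h3 : Tendsto (fun n : ℕ => ((n:ℝ))⁻¹) atTop (𝓝[≠] 0) :=
      tendsto_nhdsWithin_iff.2 ⟨tendsto_inv_atTop_nhds_zero_nat, by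
        filter_upwards [eventually_gt_atTop 0] with n hn
        have hn' : (0:ℝ) < n := by exact_mod_cast hn
        simp [hn'.ne']⟩
    have h4 : Tendsto (fun n : ℕ => (1 / (1 - Real.exp (-(k / (B * n))))) / n) atTop
        (𝓝 (-(-(k / B)))⁻¹) := by
      refine ((h2.comp h3).neg.inv₀ ?_).congr fun n => ?_
      · rw [neg_neg]; positivity
      · simp only [Function.comp, zero_add, mul_zero, Real.exp_zero, inv_inv, smul_eq_mul]
        have e : -((k:ℝ) / B) * (n:ℝ)⁻¹ = -(k / (B * n)) := by
          rw [← div_eq_mul_inv, neg_div, div_div]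
        rw [e, ← mul_neg, neg_sub, mul_inv]
        ring
    have h5 := h1.add h4
    have h6 := hlim0.div h5 (by rw [neg_neg]; positivity)
    have e : B / (B + (-(-((k:ℝ) / B)))⁻¹) = k / (k + 1) := by
      rw [neg_neg]; field_simp
    rw [e] at h6
    refine h6.congr' ?_
    filter_upwards [eventually_gt_atTop 0, hs] with n hn hsn
    have hn' : (n:ℝ) ≠ 0 := by positivity
    have a1 : 1 - pgfIter p n 0 ≠ 0 := by linarith [(hmem n 0 (by simp)).2]
    have a2 : 1 - pgfIter p n (Real.exp (-(k / (B * n)))) ≠ 0 := by linarith [(hmem n _ hsn).2]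
    simp only [Pi.div_apply]
    rw [← add_div, sub_add_cancel]
    field_simp
  -- conditional measures
  let A : ℕ → Set Ω := fun n => {ω | 0 < Z n ω}
  have hA : ∀ n, MeasurableSet (A n) := fun n => measurableSet_lt measurable_const (hZm n)
  have hAc : ∀ n, (μ.real (A n)ᶜ) = pgfIter p n 0 := by
    intro n
    rw [← hZ n 0 (by simp), ← integral_indicator_one (hA n).compl]
    congr 1
    ext ω
    by_cases h : Z n ω = 0
    · simp [A, h]
    · simp [A, h, Nat.pos_of_ne_zero h]
  have hAr : ∀ n, μ.real (A n) = 1 - pgfIter p n 0 := by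
    intro n
    rw [← hAc n, probReal_compl_eq_one_sub (hA n)]; ring
  have hApos : ∀ n, 0 < μ.real (A n) := fun n => by
    rw [hAr]; linarith [(hmem n 0 (by simp)).2]
  have hA0 : ∀ n, μ (A n) ≠ 0 := fun n h => by
    have := hApos n
    simp [Measure.real, h] at this
  let ν : ℕ → Measure Ω := fun n => ProbabilityTheory.cond μ (A n)
  let W : ℕ → Ω → ℝ := fun n ω => Real.exp (-((Z n ω : ℝ) / (B * n)))
  have hν : ∀ n, IsProbabilityMeasure (ν n) := fun n =>
    ProbabilityTheory.cond_isProbabilityMeasure (hA0 n)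
  have hZr : ∀ n, Measurable fun ω => (Z n ω : ℝ) := fun n =>
    (measurable_of_countable (fun m : ℕ => (m:ℝ))).comp (hZm n)
  have hW : ∀ n, Measurable (W n) := fun n =>
    (Real.measurable_exp.comp ((hZr n).div_const _).neg)
  have hW1 : ∀ n ω, W n ω ∈ Set.Icc (0:ℝ) 1 := by
    intro n ω
    refine ⟨(Real.exp_pos _).le, ?_⟩
    rw [Real.exp_le_one_iff]
    have : 0 ≤ (Z n ω : ℝ) / (B * n) := by positivity
    linarith
  have hmom : ∀ k : ℕ, Tendsto (fun n => ∫ ω, W n ω ^ k ∂(ν n)) atTop (𝓝 (1 / ((k:ℝ) + 1))) := by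
    intro k
    rcases Nat.eq_zero_or_pos k with rfl | hk
    · simp
    have h1 := (hlap k hk).const_sub 1
    have e : 1 - (k:ℝ) / (k + 1) = 1 / (k + 1) := by field_simp; ring
    rw [e] at h1
    refine h1.congr fun n => ?_
    have hs1 : Real.exp (-((k:ℝ) / (B * n))) ∈ Set.Icc (0:ℝ) 1 := by
      refine ⟨(Real.exp_pos _).le, ?_⟩
      rw [Real.exp_le_one_iff]
      have : 0 ≤ (k : ℝ) / (B * n) := by positivity
      linarith
    set s := Real.exp (-((k:ℝ) / (B * n))) with hsdef
    have hWs : ∀ ω, W n ω ^ k = s ^ Z n ω := by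
      intro ω
      simp only [W, hsdef, ← Real.exp_nat_mul]
      congr 1; ring
    simp_rw [hWs]
    have hint : Integrable (fun ω => s ^ Z n ω) μ := by
      refine Integrable.of_bound ((measurable_of_countable (fun m : ℕ => s ^ m)).comp
        (hZm n)).aestronglyMeasurable 1 (Eventually.of_forall fun ω => ?_)
      rw [Real.norm_of_nonneg (pow_nonneg hs1.1 _)]
      exact pow_le_one₀ hs1.1 hs1.2
    have h2 := integral_add_compl (hA n) hint
    have h3 : ∫ ω in (A n)ᶜ, s ^ Z n ω ∂μ = pgfIter p n 0 := by
      rw [← hAc n]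
      rw [setIntegral_congr_fun (g := fun _ => (1:ℝ)) (hA n).compl]
      · simp
      · intro ω hω
        have : Z n ω = 0 := by simpa [A] using hω
        simp [this]
    rw [h3, hZ n s hs1] at h2
    have h4 : ∫ ω, s ^ Z n ω ∂(ν n) = (μ.real (A n))⁻¹ * ∫ ω in A n, s ^ Z n ω ∂μ := by
      simp only [ν, ProbabilityTheory.cond]
      rw [integral_smul_measure, ENNReal.toReal_inv]
      rfl
    have h5 : ∫ ω in A n, s ^ Z n ω ∂μ = pgfIter p n s - pgfIter p n 0 := by linarith
    have h6 := (hApos n).ne'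
    rw [h4, h5]
    rw [hAr] at h6 ⊢
    field_simp
    ring
  have hfin := unif_lim ν hν W hW hW1 hmom (Real.exp (-y))
    ⟨(Real.exp_pos _).le, by rw [Real.exp_le_one_iff]; linarith⟩
  refine hfin.congr' ?_
  filter_upwards [eventually_gt_atTop 0] with n hn
  have hn' : (0:ℝ) < n := by exact_mod_cast hn
  have hset : A n ∩ {ω | Real.exp (-y) ≤ W n ω} = {ω | 0 < Z n ω ∧ (Z n ω : ℝ) ≤ B * n * y} := by
    ext ω
    simp only [A, W, Set.mem_inter_iff, Set.mem_setOf_eq, Real.exp_le_exp, neg_le_neg_iff]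
    rw [div_le_iff₀ (by positivity), mul_comm y]
  simp only [ν, Measure.real]
  rw [ProbabilityTheory.cond_apply (hA n), hset, ENNReal.toReal_mul, ENNReal.toReal_inv, mul_comm,
    div_eq_mul_inv]
end

section
/- Under criticality (E[ξ]=1, Var(ξ)=2B ∈ (0,∞)), for any fixed k ∈ ℕ, k ≥ 1, and any fixed x ∈ (0,∞), the k-th derivative of the n-th iterate of f evaluated at f_{⌊xn⌋}(0) satisfies f_n^{(k)}(f_{⌊xn⌋}(0)) ~ k! x² (Bxn)^{k-1} / (x+1)^{k+1} as n → ∞. -/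
open MeasureTheory Filter Topology Asymptotics Real

/-- absolute monotonicity of order `k` on the unit interval -/
def AbsMon : ℕ → (ℝ → ℝ) → Prop
  | 0, g => ∀ s ∈ Set.Ioo (0:ℝ) 1, 0 ≤ g s
  | k + 1, g => (∀ s ∈ Set.Ioo (0:ℝ) 1, 0 ≤ g s) ∧
      ∃ g' : ℝ → ℝ, (∀ s ∈ Set.Ioo (0:ℝ) 1, HasDerivAt g (g' s) s) ∧ AbsMon k g'

lemma AbsMon.nonneg {k : ℕ} {g : ℝ → ℝ} (h : AbsMon k g) : ∀ s ∈ Set.Ioo (0:ℝ) 1, 0 ≤ g s := by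
  cases k with
  | zero => exact h
  | succ k => exact h.1

lemma AbsMon.pred {k : ℕ} {g : ℝ → ℝ} (h : AbsMon (k+1) g) : AbsMon k g := by
  induction k generalizing g with
  | zero => exact h.1
  | succ k ih =>
    obtain ⟨h0, g', h1, h2⟩ := h
    exact ⟨h0, g', h1, ih h2⟩

lemma AbsMon.congr {k : ℕ} {g g₁ : ℝ → ℝ} (h : AbsMon k g) (e : Set.EqOn g₁ g (Set.Ioo 0 1)) :
    AbsMon k g₁ := by
  cases k with
  | zero => intro s hs; rw [e hs]; exact h s hs
  | succ k =>
    obtain ⟨h0, g', h1, h2⟩ := h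
    refine ⟨fun s hs => by rw [e hs]; exact h0 s hs, g', fun s hs => ?_, h2⟩
    exact (h1 s hs).congr_of_eventuallyEq (e.eventuallyEq_of_mem (isOpen_Ioo.mem_nhds hs))

lemma AbsMon.add {k : ℕ} {g h : ℝ → ℝ} (hg : AbsMon k g) (hh : AbsMon k h) :
    AbsMon k (fun s => g s + h s) := by
  induction k generalizing g h with
  | zero => exact fun s hs => add_nonneg (hg s hs) (hh s hs)
  | succ k ih =>
    obtain ⟨h0, g', h1, h2⟩ := hg
    obtain ⟨k0, h', k1, k2⟩ := hh
    exact ⟨fun s hs => add_nonneg (h0 s hs) (k0 s hs), _,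
      fun s hs => (h1 s hs).add (k1 s hs), ih h2 k2⟩

lemma AbsMon.mul {k : ℕ} {g h : ℝ → ℝ} (hg : AbsMon k g) (hh : AbsMon k h) :
    AbsMon k (fun s => g s * h s) := by
  induction k generalizing g h with
  | zero => exact fun s hs => mul_nonneg (hg s hs) (hh s hs)
  | succ k ih =>
    have hg' := hg.pred
    have hh' := hh.pred
    obtain ⟨h0, g', h1, h2⟩ := hg
    obtain ⟨k0, h', k1, k2⟩ := hh
    exact ⟨fun s hs => mul_nonneg (h0 s hs) (k0 s hs), _,
      fun s hs => (h1 s hs).mul (k1 s hs), (ih h2 hh').add (ih hg' k2)⟩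

lemma AbsMon.comp {k : ℕ} {g h : ℝ → ℝ} (hg : AbsMon k g) (hh : AbsMon k h)
    (hm : Set.MapsTo h (Set.Ioo 0 1) (Set.Ioo 0 1)) :
    AbsMon k (fun s => g (h s)) := by
  induction k generalizing g with
  | zero => exact fun s hs => hg _ (hm hs)
  | succ k ih =>
    have hh' := hh.pred
    obtain ⟨h0, g', h1, h2⟩ := hg
    obtain ⟨k0, h', k1, k2⟩ := hh
    exact ⟨fun s hs => h0 _ (hm hs), _,
      fun s hs => (h1 _ (hm hs)).comp s (k1 s hs), (ih h2 hh').mul k2⟩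

lemma AbsMon.deriv {k : ℕ} {g : ℝ → ℝ} (hg : AbsMon (k+1) g) : AbsMon k (deriv g) := by
  obtain ⟨h0, g', h1, h2⟩ := hg
  exact h2.congr fun s hs => (h1 s hs).deriv

lemma AbsMon.iteratedDeriv {k : ℕ} (j : ℕ) {g : ℝ → ℝ} (hg : AbsMon (k+j) g) :
    AbsMon k (iteratedDeriv j g) := by
  induction j generalizing k with
  | zero => simpa using hg
  | succ j ih =>
    rw [iteratedDeriv_succ]
    apply AbsMon.deriv
    apply ih
    rwa [show k + 1 + j = k + (j+1) by ring]

lemma AbsMon.hasDerivAt {k : ℕ} {g : ℝ → ℝ} (hg : AbsMon (k+1) g) {s : ℝ}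
    (hs : s ∈ Set.Ioo (0:ℝ) 1) : HasDerivAt g (_root_.deriv g s) s := by
  obtain ⟨h0, g', h1, h2⟩ := hg
  rw [(h1 s hs).deriv]; exact h1 s hs

lemma AbsMon.monotoneOn {k : ℕ} {g : ℝ → ℝ} (hg : AbsMon (k+1) g) :
    MonotoneOn g (Set.Ioo 0 1) := by
  apply monotoneOn_of_deriv_nonneg (convex_Ioo 0 1)
  · exact fun s hs => (hg.hasDerivAt hs).continuousAt.continuousWithinAt
  · rw [interior_Ioo]
    exact fun s hs => (hg.hasDerivAt hs).differentiableAt.differentiableWithinAt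
  · rw [interior_Ioo]
    exact hg.deriv.nonneg

lemma pow_secant {r R : ℝ} (hr : 0 ≤ r) (h : r ≤ R) (k : ℕ) :
    k * r ^ (k-1) * (R - r) ≤ R ^ k - r ^ k := by
  induction k with
  | zero => simp
  | succ k ih =>
    rcases Nat.eq_zero_or_pos k with rfl | hk
    · simp
    have e : r ^ k = r * r ^ (k-1) := by rw [← pow_succ', Nat.sub_add_cancel hk]
    have h1 : r ^ k ≤ R ^ k := pow_le_pow_left₀ hr h k
    simp only [Nat.add_sub_cancel, Nat.cast_add, Nat.cast_one]
    rw [pow_succ R, pow_succ r]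
    have h2 : (k:ℝ) * r ^ k * (R - r) = r * (k * r^(k-1) * (R - r)) := by rw [e]; ring
    nlinarith [mul_le_mul_of_nonneg_left ih hr, mul_nonneg (sub_nonneg.2 h) (sub_nonneg.2 h1)]

lemma absMon_series (k : ℕ) (a : ℕ → ℝ) (ha : ∀ n, 0 ≤ a n)
    (hs : ∀ r ∈ Set.Ioo (0:ℝ) 1, Summable fun n => a n * r ^ n) :
    AbsMon k (fun s => ∑' n, a n * s ^ n) := by
  induction k generalizing a with
  | zero => exact fun s h => tsum_nonneg fun n => mul_nonneg (ha n) (pow_nonneg h.1.le n)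
  | succ k ih =>
    have hs' : ∀ r ∈ Set.Ioo (0:ℝ) 1, Summable fun n => a n * (n * r ^ (n-1)) := by
      intro r hr
      obtain ⟨R, h1, h2⟩ := exists_between hr.2
      have hR : R ∈ Set.Ioo (0:ℝ) 1 := ⟨hr.1.trans h1, h2⟩
      refine Summable.of_nonneg_of_le (fun n => ?_) (fun n => ?_) ((hs R hR).mul_right (R - r)⁻¹)
      · exact mul_nonneg (ha n) (mul_nonneg (by positivity) (pow_nonneg hr.1.le _))
      · rw [mul_assoc]
        apply mul_le_mul_of_nonneg_left _ (ha n)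
        rw [← div_eq_mul_inv, le_div_iff₀ (sub_pos.2 h1)]
        have := pow_secant hr.1.le h1.le n
        have := pow_nonneg hr.1.le n
        linarith
    have hshift : ∀ r ∈ Set.Ioo (0:ℝ) 1, Summable fun n : ℕ => ((n+1) * a (n+1)) * r ^ n := by
      intro r hr
      have := (summable_nat_add_iff 1).2 (hs' r hr)
      refine this.congr fun n => ?_
      simp only [Nat.add_sub_cancel, Nat.cast_add, Nat.cast_one]
      ring
    refine ⟨fun s h => tsum_nonneg fun n => mul_nonneg (ha n) (pow_nonneg h.1.le n),
      fun s => ∑' n : ℕ, ((n+1) * a (n+1)) * s ^ n, fun s h => ?_,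
      ih _ (fun n => mul_nonneg (by positivity) (ha _)) hshift⟩
    obtain ⟨r, h1, h2⟩ := exists_between h.2
    have hr : r ∈ Set.Ioo (0:ℝ) 1 := ⟨h.1.trans h1, h2⟩
    have key := hasDerivAt_tsum_of_isPreconnected (hs' r hr) (isOpen_Ioo (a := (0:ℝ)) (b := r))
      isPreconnected_Ioo (g := fun n s => a n * s ^ n)
      (g' := fun n s => a n * (n * s ^ (n-1)))
      (fun n y hy => (hasDerivAt_pow n y).const_mul (a n))
      (fun n y hy => by
        rw [Real.norm_of_nonneg (mul_nonneg (ha n) (mul_nonneg (by positivity) (pow_nonneg hy.1.le _)))]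
        exact mul_le_mul_of_nonneg_left (mul_le_mul_of_nonneg_left
          (pow_le_pow_left₀ hy.1.le hy.2.le _) (by positivity)) (ha n))
      (⟨h.1, h1⟩ : s ∈ Set.Ioo 0 r) (hs s h) (⟨h.1, h1⟩ : s ∈ Set.Ioo 0 r)
    refine key.congr_deriv ?_
    rw [(hs' s h).tsum_eq_zero_add]
    simp only [Nat.cast_zero, zero_mul, mul_zero, zero_add, Nat.add_sub_cancel, Nat.cast_add, Nat.cast_one]
    exact tsum_congr fun n => by ring

lemma conv_deriv (G G' : ℕ → ℝ → ℝ) (g g' : ℝ → ℝ)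
    (hG : ∀ R : ℝ, ∀ᶠ n in atTop, (∀ t ∈ Set.Ioo 0 R, HasDerivAt (G n) (G' n t) t) ∧
      MonotoneOn (G' n) (Set.Ioo 0 R))
    (hlim : ∀ t, 0 < t → Tendsto (fun n => G n t) atTop (𝓝 (g t)))
    (hg : ∀ t, 0 < t → HasDerivAt g (g' t) t)
    (hc : ∀ t, 0 < t → ContinuousAt g' t)
    (u : ℕ → ℝ) (t : ℝ) (ht : 0 < t) (hu : Tendsto u atTop (𝓝 t)) :
    Tendsto (fun n => G' n (u n)) atTop (𝓝 (g' t)) := by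
  -- upper and lower bounds
  have mvt : ∀ a b, 0 < a → a < b → ∃ c ∈ Set.Ioo a b, (g b - g a) / (b - a) = g' c := by
    intro a b ha hab
    obtain ⟨c, hc1, hc2⟩ := exists_hasDerivAt_eq_slope g g' hab
      (fun x hx => (hg x (ha.trans_le hx.1)).continuousAt.continuousWithinAt)
      (fun x hx => hg x (ha.trans hx.1))
    exact ⟨c, hc1, hc2.symm⟩
  have slope : ∀ a b, 0 < a → a < b → ∀ᶠ n in atTop,
      G' n a ≤ (G n b - G n a) / (b - a) ∧ (G n b - G n a) / (b - a) ≤ G' n b := by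
    intro a b ha hab
    filter_upwards [hG (b+1)] with n ⟨h1, h2⟩
    obtain ⟨c, hc1, hc2⟩ := exists_hasDerivAt_eq_slope (G n) (G' n) hab
      (fun x hx => (h1 x ⟨ha.trans_le hx.1, by linarith [hx.2]⟩).continuousAt.continuousWithinAt)
      (fun x hx => h1 x ⟨ha.trans hx.1, by linarith [hx.2]⟩)
    rw [← hc2]
    have hc1' := hc1.1
    have hc1'' := hc1.2
    exact ⟨h2 ⟨ha, by linarith⟩ ⟨by linarith, by linarith⟩ hc1'.le,
      h2 ⟨by linarith, by linarith⟩ ⟨by linarith, by linarith⟩ hc1''.le⟩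
  have slim : ∀ a b, 0 < a → a < b →
      Tendsto (fun n => (G n b - G n a) / (b - a)) atTop (𝓝 ((g b - g a)/(b-a))) :=
    fun a b ha hab => ((hlim b (ha.trans hab)).sub (hlim a ha)).div_const _
  rw [tendsto_order]
  constructor
  · intro y hy
    obtain ⟨η, hη, hball⟩ := Metric.eventually_nhds_iff.1 ((hc t ht).eventually (lt_mem_nhds hy))
    set d := min η t / 3 with hd
    have hm : 0 < min η t := lt_min hη ht
    have hd0 : 0 < d := by positivity
    have hd1 : 3 * d ≤ η := by have := min_le_left η t; linarith
    have hd2 : 3 * d ≤ t := by have := min_le_right η t; linarith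
    obtain ⟨c, hc1, hc2⟩ := mvt (t - 2*d) (t - d) (by linarith) (by linarith)
    have hyc : y < g' c := hball (by
      rw [Real.dist_eq, abs_lt]; constructor <;> linarith [hc1.1, hc1.2])
    have h3 := slim (t - 2*d) (t - d) (by linarith) (by linarith)
    rw [hc2] at h3
    filter_upwards [h3.eventually (lt_mem_nhds hyc), slope (t - 2*d) (t - d) (by linarith) (by linarith),
      hG (t+1), hu.eventually (lt_mem_nhds (show t - d < t by linarith)),
      hu.eventually (gt_mem_nhds (show t < t + 1 by linarith))] with n e1 e2 e3 e4 e5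
    exact e1.trans_le (e2.2.trans (e3.2 ⟨by linarith, by linarith⟩ ⟨by linarith, e5⟩ e4.le))
  · intro y hy
    obtain ⟨η, hη, hball⟩ := Metric.eventually_nhds_iff.1 ((hc t ht).eventually (gt_mem_nhds hy))
    set d := η / 3 with hd
    have hd0 : 0 < d := by positivity
    have hd1 : 3 * d ≤ η := by linarith
    obtain ⟨c, hc1, hc2⟩ := mvt (t + d) (t + 2*d) (by linarith) (by linarith)
    have hyc : g' c < y := hball (by
      rw [Real.dist_eq, abs_lt]; constructor <;> linarith [hc1.1, hc1.2])
    have h3 := slim (t + d) (t + 2*d) (by linarith) (by linarith)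
    rw [hc2] at h3
    filter_upwards [h3.eventually (gt_mem_nhds hyc), slope (t + d) (t + 2*d) (by linarith) (by linarith),
      hG (t+d+1), hu.eventually (gt_mem_nhds (show t < t + d by linarith)),
      hu.eventually (lt_mem_nhds (show 0 < t by linarith))] with n e1 e2 e3 e4 e5
    exact ((e3.2 ⟨e5, by linarith⟩ ⟨by linarith, by linarith⟩ e4.le).trans e2.1).trans_lt e1

/-- second order difference quotient of the monomial -/
noncomputable def Qc (k : ℕ) (s : ℝ) : ℝ := ∑ i ∈ Finset.range k, ∑ j ∈ Finset.range i, s ^ j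

lemma Qc_eq (k : ℕ) (s : ℝ) : (1-s)^2 * Qc k s = s ^ k - 1 + k * (1-s) := by
  induction k with
  | zero => simp [Qc]
  | succ k ih =>
    have h : (1 - s) * ∑ j ∈ Finset.range k, s ^ j = 1 - s ^ k := mul_neg_geom_sum s k
    unfold Qc at *
    rw [Finset.sum_range_succ, mul_add, ih, sq, mul_assoc, h]
    push_cast; ring

lemma Qc_mono (k : ℕ) {s t : ℝ} (hs : 0 ≤ s) (h : s ≤ t) : Qc k s ≤ Qc k t := by
  unfold Qc
  gcongr

lemma Qc_nonneg (k : ℕ) {s : ℝ} (hs : 0 ≤ s) : 0 ≤ Qc k s := by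
  unfold Qc
  positivity

lemma Qc_one (k : ℕ) : Qc k 1 = ((k:ℝ)^2 - k) / 2 := by
  unfold Qc
  induction k with
  | zero => simp
  | succ k ih => rw [Finset.sum_range_succ, ih]; simp; ring

lemma Qc_cont (k : ℕ) : Continuous (Qc k) := by
  unfold Qc
  fun_prop

lemma Qc_zero_pos {k : ℕ} (hk : 2 ≤ k) : 0 < Qc k 0 := by
  have := Qc_eq k 0
  have h2 : (2:ℝ) ≤ k := by exact_mod_cast hk
  rw [zero_pow (by omega)] at this
  norm_num at this
  linarith

lemma pgf_core (p : ℕ → ℝ) (hp0 : ∀ k, 0 ≤ p k) (hp1 : ∑' k, p k = 1)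
    (hmean : ∑' k : ℕ, (k : ℝ) * p k = 1) (B : ℝ) (hB : 0 < B)
    (hsq : Summable fun k : ℕ => (k : ℝ) ^ 2 * p k)
    (hvar : (∑' k : ℕ, (k : ℝ) ^ 2 * p k) - 1 = 2 * B) :
    ∃ D : ℝ → ℝ, ∃ q > 0, Tendsto D (𝓝[<] 1) (𝓝 B) ∧ ∀ s ∈ Set.Ico (0:ℝ) 1,
      pgf p s < 1 ∧ s ≤ pgf p s ∧ q ≤ D s ∧ (1 - pgf p s)⁻¹ = (1-s)⁻¹ + D s := by
  have sp : Summable p := by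
    by_contra h; rw [tsum_eq_zero_of_not_summable h] at hp1; norm_num at hp1
  have sm : Summable fun k : ℕ => (k:ℝ) * p k := by
    by_contra h; rw [tsum_eq_zero_of_not_summable h] at hmean; norm_num at hmean
  have sQ1 : Summable fun k => p k * Qc k 1 := by
    refine ((hsq.sub sm).mul_right (1/2)).congr fun k => ?_
    rw [Qc_one]; ring
  have tQ1 : ∑' k, p k * Qc k 1 = B := by
    have : ∑' k, p k * Qc k 1 = ∑' k : ℕ, ((k : ℝ) ^ 2 * p k - (k:ℝ) * p k) * (1/2) :=
      tsum_congr fun k => by rw [Qc_one]; ring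
    rw [this, tsum_mul_right, hsq.tsum_sub sm, hmean]
    linarith
  have sQ : ∀ s ∈ Set.Icc (0:ℝ) 1, Summable fun k => p k * Qc k s := fun s hs =>
    Summable.of_nonneg_of_le (fun k => mul_nonneg (hp0 k) (Qc_nonneg k hs.1))
      (fun k => mul_le_mul_of_nonneg_left (Qc_mono k hs.1 hs.2) (hp0 k)) sQ1
  have sf : ∀ s ∈ Set.Icc (0:ℝ) 1, Summable fun k => p k * s ^ k := fun s hs =>
    Summable.of_nonneg_of_le (fun k => mul_nonneg (hp0 k) (pow_nonneg hs.1 k))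
      (fun k => mul_le_of_le_one_right (hp0 k) (pow_le_one₀ hs.1 hs.2)) sp
  set Q : ℝ → ℝ := fun s => ∑' k, p k * Qc k s with hQ
  have Qeq : ∀ s ∈ Set.Icc (0:ℝ) 1, pgf p s = s + (1-s)^2 * Q s := by
    intro s hs
    have h1 : (1-s)^2 * Q s = ∑' k : ℕ, ((p k * s ^ k - p k) + (k * p k) * (1-s)) := by
      rw [hQ]
      simp only
      rw [← tsum_mul_left]
      refine tsum_congr fun k => ?_
      have := Qc_eq k s
      linear_combination p k * this
    rw [h1, (((sf s hs).sub sp)).tsum_add (sm.mul_right (1-s)), (sf s hs).tsum_sub sp, hp1,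
      tsum_mul_right, hmean]
    unfold pgf; ring
  have Qcont : ContinuousOn Q (Set.Icc 0 1) := by
    refine continuousOn_tsum (fun k => (continuous_const.mul (Qc_cont k)).continuousOn) sQ1 ?_
    intro k s hs
    rw [Real.norm_of_nonneg (mul_nonneg (hp0 k) (Qc_nonneg k hs.1))]
    exact mul_le_mul_of_nonneg_left (Qc_mono k hs.1 hs.2) (hp0 k)
  have hpos : ∃ k, 2 ≤ k ∧ 0 < p k := by
    by_contra! h
    have : ∀ k, p k * Qc k 1 = 0 := by
      intro k
      by_cases hk : 2 ≤ k
      · rw [le_antisymm (h k hk) (hp0 k), zero_mul]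
      · rw [Qc_one]
        interval_cases k <;> simp
    simp [this] at tQ1
    linarith
  obtain ⟨k0, hk0, hpk0⟩ := hpos
  have Q0 : 0 < Q 0 := (sQ 0 (by simp)).tsum_pos
    (fun k => mul_nonneg (hp0 k) (Qc_nonneg k le_rfl)) k0 (mul_pos hpk0 (Qc_zero_pos hk0))
  have Qmono : ∀ s ∈ Set.Icc (0:ℝ) 1, Q 0 ≤ Q s := fun s hs =>
    (sQ 0 (by simp)).tsum_le_tsum
      (fun k => mul_le_mul_of_nonneg_left (Qc_mono k le_rfl hs.1) (hp0 k)) (sQ s hs)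
  refine ⟨fun s => Q s / (1 - (1-s) * Q s), Q 0, Q0, ?_, ?_⟩
  · have h1 : Tendsto Q (𝓝[<] 1) (𝓝 B) := by
      have := (Qcont 1 (by simp)).mono_of_mem_nhdsWithin (s := Set.Iio 1)
        (mem_of_superset (Ico_mem_nhdsLT (show (0:ℝ) < 1 by norm_num)) Set.Ico_subset_Icc_self)
      unfold ContinuousWithinAt at this
      rwa [show Q 1 = B from tQ1] at this
    have h2 : Tendsto (fun s : ℝ => s) (𝓝[<] 1) (𝓝 1) := tendsto_nhdsWithin_of_tendsto_nhds tendsto_id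
    have := h1.div (((tendsto_const_nhds (x := (1:ℝ))).sub (((tendsto_const_nhds (x := (1:ℝ))).sub h2).mul h1))) (by norm_num)
    simp only [sub_self, zero_mul, sub_zero, div_one] at this
    exact this
  · intro s hs
    have hs' : s ∈ Set.Icc (0:ℝ) 1 := Set.Ico_subset_Icc_self hs
    have lt1 : pgf p s < 1 := by
      rw [← hp1]
      refine Summable.tsum_lt_tsum (i := k0)
        (fun k => mul_le_of_le_one_right (hp0 k) (pow_le_one₀ hs'.1 hs'.2)) ?_ (sf s hs') sp
      exact mul_lt_of_lt_one_right hpk0 (pow_lt_one₀ hs.1 hs.2 (by omega))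
    have hQs : 0 < Q s := Q0.trans_le (Qmono s hs')
    have e := Qeq s hs'
    have h1s : 0 < 1 - s := by linarith [hs.2]
    have e2 : 1 - pgf p s = (1 - s) * (1 - (1-s) * Q s) := by rw [e]; ring
    have hd : 0 < 1 - (1-s) * Q s := by
      have : 0 < (1 - s) * (1 - (1-s) * Q s) := by rw [← e2]; linarith
      exact (mul_pos_iff_of_pos_left h1s).1 this
    refine ⟨lt1, by rw [e]; linarith [mul_pos (pow_pos h1s 2) hQs], ?_, ?_⟩
    · rw [le_div_iff₀ hd]
      have := Qmono s hs'
      nlinarith [mul_pos h1s hQs, mul_pos (mul_pos h1s hQs) Q0]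
    · show _ = _ + Q s / (1 - (1-s) * Q s)
      rw [e2]
      generalize Q s = z at *
      have h1 := h1s.ne'
      have h2 := hd.ne'
      rw [mul_inv, inv_eq_one_div, inv_eq_one_div, div_mul_div_comm, div_add_div _ _ h1 h2,
        div_eq_div_iff (mul_ne_zero h1 h2) (mul_ne_zero h1 h2)]
      ring

lemma iter_limits (p : ℕ → ℝ) (B : ℝ) (hB : 0 < B) (D : ℝ → ℝ) (q : ℝ) (hq : 0 < q)
    (hD : Tendsto D (𝓝[<] 1) (𝓝 B))
    (h : ∀ s ∈ Set.Ico (0:ℝ) 1,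
      pgf p s < 1 ∧ s ≤ pgf p s ∧ q ≤ D s ∧ (1 - pgf p s)⁻¹ = (1-s)⁻¹ + D s) :
    (∀ n, ∀ s ∈ Set.Ico (0:ℝ) 1, pgfIter p n s ∈ Set.Ico s 1) ∧
    (∀ y : ℝ, 0 < y → Tendsto (fun n : ℕ => (n:ℝ) * (pgfIter p n (1 - y / n) - 1)) atTop
      (𝓝 (-(y / (1 + B * y))))) ∧
    (∀ x : ℝ, 0 < x → Tendsto (fun n : ℕ => (n:ℝ) * (1 - pgfIter p ⌊x * (n : ℝ)⌋₊ 0)) atTop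
      (𝓝 (1 / (B * x)))) := by
  have hmem : ∀ n, ∀ s ∈ Set.Ico (0:ℝ) 1, pgfIter p n s ∈ Set.Ico s 1 := by
    intro n s hs
    induction n with
    | zero => exact ⟨le_rfl, hs.2⟩
    | succ n ih =>
      have := h _ ⟨hs.1.trans ih.1, ih.2⟩
      exact ⟨ih.1.trans this.2.1, this.1⟩
  have hmem0 : ∀ n, ∀ s ∈ Set.Ico (0:ℝ) 1, pgfIter p n s ∈ Set.Ico (0:ℝ) 1 :=
    fun n s hs => ⟨hs.1.trans (hmem n s hs).1, (hmem n s hs).2⟩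
  have hstep : ∀ n, ∀ s ∈ Set.Ico (0:ℝ) 1,
      (1 - pgfIter p (n+1) s)⁻¹ = (1 - pgfIter p n s)⁻¹ + D (pgfIter p n s) :=
    fun n s hs => (h _ (hmem0 n s hs)).2.2.2
  refine ⟨hmem, ?_, ?_⟩
  · intro y hy
    have key : Tendsto (fun n : ℕ => (1 - pgfIter p n (1 - y / n))⁻¹ / n) atTop (𝓝 (1/y + B)) := by
      rw [Metric.tendsto_atTop']
      intro ε hε
      have h1 := hD.eventually (Metric.ball_mem_nhds B (half_pos hε))
      obtain ⟨l, hl, hl2⟩ := (mem_nhdsLT_iff_exists_Ioo_subset' (show (0:ℝ) < 1 by norm_num)).1 h1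
      have hlim : Tendsto (fun n : ℕ => 1 - y / (n:ℝ)) atTop (𝓝 1) := by
        simpa using (tendsto_const_nhds (x := (1:ℝ))).sub (tendsto_const_div_atTop_nhds_zero_nat y)
      have hev := (hlim.eventually (lt_mem_nhds hl)).and
        ((hlim.eventually (lt_mem_nhds (show (0:ℝ) < 1 by norm_num))).and (eventually_gt_atTop 0))
      obtain ⟨N, hN⟩ := eventually_atTop.1 hev
      refine ⟨N, fun n hn => ?_⟩
      obtain ⟨a1, a2, a3⟩ := hN n hn.le
      have hn0 : (0:ℝ) < n := by exact_mod_cast a3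
      set s := 1 - y / (n:ℝ) with hs
      have hs1 : s < 1 := by have : 0 < y / n := by positivity
                             linarith
      have hsm : s ∈ Set.Ico (0:ℝ) 1 := ⟨a2.le, hs1⟩
      have ind : ∀ j : ℕ, |(1 - pgfIter p j s)⁻¹ - (1-s)⁻¹ - j * B| ≤ j * (ε/2) := by
        intro j
        induction j with
        | zero => simp [pgfIter]
        | succ j ih =>
          rw [hstep j s hsm]
          have hm := hmem j s hsm
          have : |D (pgfIter p j s) - B| < ε/2 := hl2 ⟨a1.trans_le hm.1, hm.2⟩
          rw [abs_le] at *
          rw [abs_lt] at this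
          push_cast
          constructor <;> linarith [this.1, this.2, ih.1, ih.2]
      have h3 := ind n
      have e : (1-s)⁻¹ = n / y := by rw [hs]; simp
      rw [e] at h3
      rw [Real.dist_eq]
      have : (1 - pgfIter p n s)⁻¹ / n - (1/y + B) = ((1 - pgfIter p n s)⁻¹ - n / y - n * B) / n := by
        field_simp
        try ring
      rw [this, abs_div, abs_of_pos hn0, div_lt_iff₀ hn0]
      nlinarith
    have h2 := (key.inv₀ (by positivity)).neg
    have e : -(1 / y + B)⁻¹ = -(y / (1 + B * y)) := by
      field_simp
      try ring
    rw [e] at h2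
    refine h2.congr fun n => ?_
    rw [inv_div, div_inv_eq_mul]; ring
  · intro x hx
    have h0 : (0:ℝ) ∈ Set.Ico (0:ℝ) 1 := by simp
    have grow : ∀ m : ℕ, m * q ≤ (1 - pgfIter p m 0)⁻¹ := by
      intro m
      induction m with
      | zero => simp [pgfIter]
      | succ m ih =>
        rw [hstep m 0 h0]
        have := (h _ (hmem0 m 0 h0)).2.2.1
        push_cast; linarith
    have lim1 : Tendsto (fun m => pgfIter p m 0) atTop (𝓝[<] 1) := by
      have t1 : Tendsto (fun m => (1 - pgfIter p m 0)⁻¹) atTop atTop :=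
        tendsto_atTop_mono grow (tendsto_natCast_atTop_atTop.atTop_mul_const hq)
      have t2 := t1.inv_tendsto_atTop
      have t3 := (tendsto_const_nhds (x := (1:ℝ))).sub t2
      refine tendsto_nhdsWithin_iff.2 ⟨?_, Eventually.of_forall fun m => (hmem m 0 h0).2⟩
      simpa using t3
    have ces := (hD.comp lim1).cesaro
    have hsum : ∀ m : ℕ, (1 - pgfIter p m 0)⁻¹ = 1 + ∑ i ∈ Finset.range m, (D ∘ fun m => pgfIter p m 0) i := by
      intro m
      induction m with
      | zero => simp [pgfIter]
      | succ m ih => rw [hstep m 0 h0, ih, Finset.sum_range_succ]; simp [add_assoc]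
    have t4 : Tendsto (fun m : ℕ => (1 - pgfIter p m 0)⁻¹ / (m:ℝ)) atTop (𝓝 B) := by
      have := (tendsto_const_div_atTop_nhds_zero_nat (1:ℝ)).add ces
      rw [zero_add] at this
      refine this.congr fun m => ?_
      rw [hsum m]; ring
    have fl : Tendsto (fun n : ℕ => ⌊x * (n:ℝ)⌋₊) atTop atTop :=
      tendsto_nat_floor_atTop.comp (tendsto_natCast_atTop_atTop.const_mul_atTop hx)
    have fr : Tendsto (fun n : ℕ => (⌊x * (n:ℝ)⌋₊ : ℝ) / n) atTop (𝓝 x) :=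
      (tendsto_nat_floor_mul_div_atTop hx.le).comp tendsto_natCast_atTop_atTop
    have t5 := (((t4.comp fl).mul fr).inv₀ (by positivity))
    rw [← one_div] at t5
    refine t5.congr' ?_
    filter_upwards [fl.eventually_gt_atTop 0] with n hn
    have hm : ((⌊x * (n:ℝ)⌋₊ : ℕ) : ℝ) ≠ 0 := by exact_mod_cast hn.ne'
    simp only [Function.comp]
    rw [div_mul_div_cancel₀ hm, inv_div, div_inv_eq_mul]

lemma absMon_pgfIter (p : ℕ → ℝ) (hp0 : ∀ k, 0 ≤ p k) (sp : Summable p)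
    (hm : ∀ n, Set.MapsTo (pgfIter p n) (Set.Ioo 0 1) (Set.Ioo 0 1)) (n k : ℕ) :
    AbsMon k (pgfIter p n) := by
  have hconst : ∀ (k : ℕ) (c : ℝ), 0 ≤ c → AbsMon k (fun _ => c) := by
    intro k
    induction k with
    | zero => exact fun c hc s _ => hc
    | succ k ih => exact fun c hc => ⟨fun s _ => hc, _, fun s _ => hasDerivAt_const s c, ih 0 le_rfl⟩
  induction n with
  | zero =>
    cases k with
    | zero => exact fun s hs => hs.1.le
    | succ k => exact ⟨fun s hs => hs.1.le, _, fun s _ => hasDerivAt_id s, hconst k 1 zero_le_one⟩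
  | succ n ih =>
    refine AbsMon.comp (g := pgf p) (absMon_series k p hp0 fun r hr => ?_) ih (hm n)
    exact Summable.of_nonneg_of_le (fun k => mul_nonneg (hp0 k) (pow_nonneg hr.1.le k))
      (fun k => mul_le_of_le_one_right (hp0 k) (pow_le_one₀ hr.1.le hr.2.le)) sp

lemma step_limits (F : ℕ → ℝ → ℝ) (hF : ∀ n k, AbsMon k (F n)) (k : ℕ) (c : ℝ) (L L' : ℝ → ℝ)
    (h : ∀ t : ℝ, 0 < t → Tendsto (fun n : ℕ => (n:ℝ) * (iteratedDeriv k (F n) (1 - t / n) - c) / (n:ℝ)^k)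
      atTop (𝓝 (L t)))
    (hL : ∀ t, 0 < t → HasDerivAt L (- L' t) t) (hL' : ∀ t, 0 < t → ContinuousAt L' t)
    (u : ℕ → ℝ) (t : ℝ) (ht : 0 < t) (hu : Tendsto u atTop (𝓝 t)) :
    Tendsto (fun n : ℕ => (n:ℝ) * iteratedDeriv (k+1) (F n) (1 - u n / n) / (n:ℝ)^(k+1))
      atTop (𝓝 (L' t)) := by
  have := conv_deriv (fun n t => (n:ℝ) * (iteratedDeriv k (F n) (1 - t / n) - c) / (n:ℝ)^k)
    (fun n t => - ((n:ℝ) * iteratedDeriv (k+1) (F n) (1 - t / n) / (n:ℝ)^(k+1))) L (fun t => - L' t)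
    ?_ h hL (fun t ht => (hL' t ht).neg) u t ht hu
  · simpa using this.neg
  intro R
  filter_upwards [eventually_gt_atTop ⌈R⌉₊, eventually_gt_atTop 0] with n hn hn'
  have hn0 : (0:ℝ) < n := by exact_mod_cast hn'
  have hRn : R < n := (Nat.le_ceil R).trans_lt (by exact_mod_cast hn)
  have mem : ∀ t ∈ Set.Ioo 0 R, 1 - t / (n:ℝ) ∈ Set.Ioo (0:ℝ) 1 := by
    intro t ht
    have h1 : t / n < 1 := (div_lt_one hn0).2 (ht.2.trans hRn)
    have h2 : 0 < t / n := div_pos ht.1 hn0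
    constructor <;> linarith
  constructor
  · intro t ht
    have h1 : AbsMon (0+1) (iteratedDeriv k (F n)) := AbsMon.iteratedDeriv k (hF n _)
    have h2 := h1.hasDerivAt (mem t ht)
    rw [← iteratedDeriv_succ] at h2
    have h3 : HasDerivAt (fun t : ℝ => 1 - t / (n:ℝ)) (-(1 / (n:ℝ))) t :=
      ((hasDerivAt_id t).div_const (n:ℝ)).const_sub 1
    have h4 := (((h2.comp t h3).sub_const c).const_mul (n:ℝ)).div_const ((n:ℝ)^k)
    refine h4.congr_deriv ?_
    rw [pow_succ]
    field_simp
  · intro a ha b hb hab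
    have h1 : AbsMon (0+1) (iteratedDeriv (k+1) (F n)) := AbsMon.iteratedDeriv (k+1) (hF n _)
    have h2 := h1.monotoneOn (mem b hb) (mem a ha) (by gcongr)
    simp only [neg_le_neg_iff]
    gcongr

lemma all_limits (F : ℕ → ℝ → ℝ) (hF : ∀ n k, AbsMon k (F n)) (B : ℝ) (hB : 0 < B)
    (h : ∀ y : ℝ, 0 < y → Tendsto (fun n : ℕ => (n:ℝ) * (F n (1 - y / n) - 1)) atTop
      (𝓝 (-(y / (1 + B * y)))))
    (k : ℕ) : ∀ (u : ℕ → ℝ) (t : ℝ) (_ : 0 < t) (_ : Tendsto u atTop (𝓝 t)),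
    Tendsto (fun n : ℕ => (n:ℝ) * iteratedDeriv (k+1) (F n) (1 - u n / n) / (n:ℝ)^(k+1))
      atTop (𝓝 (((k+1).factorial : ℝ) * B ^ k / (1 + B * t) ^ (k + 2))) := by
  have cont : ∀ k : ℕ, ∀ t, 0 < t →
      ContinuousAt (fun t : ℝ => ((k+1).factorial : ℝ) * B ^ k / (1 + B * t) ^ (k + 2)) t := by
    intro k t ht
    have : (1 + B * t) ^ (k+2) ≠ 0 := by positivity
    fun_prop (disch := assumption)
  have hd : ∀ t : ℝ, HasDerivAt (fun t : ℝ => 1 + B * t) B t := fun t => by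
    simpa using ((hasDerivAt_id t).const_mul B).const_add 1
  induction k with
  | zero =>
    refine step_limits F hF 0 1 (fun y => -(y / (1 + B * y))) _ ?_ ?_ (cont 0)
    · simpa using h
    · intro t ht
      have h0 : 1 + B * t ≠ 0 := by positivity
      refine ((hasDerivAt_id t).div (hd t) h0).neg.congr_deriv ?_
      simp
      rw [show 1 + B * t - t * B = 1 by ring, one_div]
  | succ k ih =>
    refine step_limits F hF (k+1) 0 (fun t => ((k+1).factorial : ℝ) * B ^ k / (1 + B * t) ^ (k + 2))
      _ ?_ ?_ (cont (k+1))
    · intro t ht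
      simpa using ih (fun _ => t) t ht tendsto_const_nhds
    · intro t ht
      have h0 : 1 + B * t ≠ 0 := by positivity
      refine ((hasDerivAt_const t (((k+1).factorial : ℝ) * B ^ k)).div ((hd t).pow (k+2))
        (pow_ne_zero _ h0)).congr_deriv ?_
      rw [Nat.factorial_succ (k+1)]
      simp only [Nat.add_sub_cancel, Pi.pow_apply]
      push_cast
      field_simp
      ring
theorem iterate_deriv_asymptotics    (p : ℕ → ℝ) (hp0 : ∀ k, 0 ≤ p k) (hp1 : ∑' k, p k = 1)
    (hmean : ∑' k : ℕ, (k : ℝ) * p k = 1) (B : ℝ) (hB : 0 < B)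
    (hsq : Summable fun k : ℕ => (k : ℝ) ^ 2 * p k)
    (hvar : (∑' k : ℕ, (k : ℝ) ^ 2 * p k) - 1 = 2 * B) :
    ∀ k : ℕ, 1 ≤ k → ∀ x : ℝ, 0 < x →
      (fun n : ℕ => iteratedDeriv k (pgfIter p n) (pgfIter p ⌊x * (n : ℝ)⌋₊ 0)) ~[atTop]
        fun n : ℕ => (Nat.factorial k : ℝ) * x ^ 2 * (B * x * n) ^ (k - 1) / (x + 1) ^ (k + 1) := by
  intro k hk x hx
  obtain ⟨D, q, hq, hD, hc⟩ := pgf_core p hp0 hp1 hmean B hB hsq hvar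
  obtain ⟨hmem, lim1, lim2⟩ := iter_limits p B hB D q hq hD hc
  have sp : Summable p := by
    by_contra h; rw [tsum_eq_zero_of_not_summable h] at hp1; norm_num at hp1
  have hAM := absMon_pgfIter p hp0 sp (fun n s hs =>
    ⟨hs.1.trans_le (hmem n s ⟨hs.1.le, hs.2⟩).1, (hmem n s ⟨hs.1.le, hs.2⟩).2⟩)
  have key := all_limits (pgfIter p) hAM B hB lim1
  obtain ⟨j, rfl⟩ : ∃ j, k = j + 1 := ⟨k - 1, by omega⟩
  have h1 := key j _ (1 / (B * x)) (by positivity) (lim2 x hx)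
  have hB' := hB.ne'
  have hx' := hx.ne'
  set c : ℝ := ((j+1).factorial : ℝ) * B ^ j / (1 + B * (1 / (B * x))) ^ (j + 2) with hcdef
  have hc0 : c ≠ 0 := by positivity
  rw [isEquivalent_iff_tendsto_one]
  · have h2 := h1.div_const c
    rw [div_self hc0] at h2
    refine h2.congr' ?_
    filter_upwards [eventually_gt_atTop 0] with n hn
    have hn0 : (n:ℝ) ≠ 0 := by exact_mod_cast hn.ne'
    have e1 : 1 - (n:ℝ) * (1 - pgfIter p ⌊x * (n : ℝ)⌋₊ 0) / n = pgfIter p ⌊x * (n : ℝ)⌋₊ 0 := by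
      rw [mul_div_cancel_left₀ _ hn0]; ring
    have e2 : ((j+1).factorial : ℝ) * x ^ 2 * (B * x * n) ^ (j + 1 - 1) / (x + 1) ^ (j + 1 + 1)
        = c * (n:ℝ) ^ j := by
      have e3 : 1 + B * (1 / (B * x)) = (x + 1) / x := by field_simp
      rw [hcdef, e3, div_pow, Nat.add_sub_cancel]
      field_simp
      try ring
    simp only [Pi.div_apply]
    rw [e1, e2, pow_succ]
    generalize iteratedDeriv (j+1) (pgfIter p n) (pgfIter p ⌊x * (n : ℝ)⌋₊ 0) = z
    field_simp
  · filter_upwards [eventually_gt_atTop 0] with n hn h0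
    have hn0 : (0:ℝ) < n := by exact_mod_cast hn
    have : 0 < ((j+1).factorial : ℝ) * x ^ 2 * (B * x * n) ^ (j + 1 - 1) / (x + 1) ^ (j + 1 + 1) := by
      positivity
    linarith
end

section
/- Under criticality (E[ξ]=1, Var(ξ)=2B ∈ (0,∞)), if m = n - ⌊xφ(n)⌋ where x ∈ (0,∞) and φ(n) → ∞ with φ(n) = o(n), then for any fixed j ≥ 1, f_m^{(j)}(f_{⌊xφ(n)⌋}(0)) ~ j! (Bxφ(n))^{j+1} / (B²n²) as n → ∞. -/
open MeasureTheory Filter Topology Asymptotics Real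

/-- nonnegative derivatives up to order `N` on the unit interval -/
def AMon : ℕ → (ℝ → ℝ) → Prop
  | 0 => fun F => ∀ s ∈ Set.Ioo (0:ℝ) 1, 0 ≤ F s
  | N + 1 => fun F => (∀ s ∈ Set.Ioo (0:ℝ) 1, 0 ≤ F s) ∧
      (∀ s ∈ Set.Ioo (0:ℝ) 1, DifferentiableAt ℝ F s) ∧ AMon N (deriv F)

theorem deriv_eqOn_unit {F G : ℝ → ℝ} (h : Set.EqOn F G (Set.Ioo 0 1)) :
    Set.EqOn (deriv F) (deriv G) (Set.Ioo 0 1) := by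
  intro s hs
  exact (h.eventuallyEq_of_mem (isOpen_Ioo.mem_nhds hs)).deriv_eq

theorem AMon.congr : ∀ (N : ℕ) {F G : ℝ → ℝ}, Set.EqOn F G (Set.Ioo 0 1) → AMon N F → AMon N G
  | 0, _, _, h, hF => fun s hs => (h hs) ▸ hF s hs
  | N + 1, _, _, h, hF => ⟨fun s hs => (h hs) ▸ hF.1 s hs,
      fun s hs => (hF.2.1 s hs).congr_of_eventuallyEq
        (h.eventuallyEq_of_mem (isOpen_Ioo.mem_nhds hs)).symm,
      AMon.congr N (deriv_eqOn_unit h) hF.2.2⟩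

theorem AMon.nonneg : ∀ {N : ℕ} {F : ℝ → ℝ}, AMon N F → ∀ s ∈ Set.Ioo (0:ℝ) 1, 0 ≤ F s
  | 0, _, h => h
  | _ + 1, _, h => h.1

theorem AMon.pred : ∀ {N : ℕ} {F : ℝ → ℝ}, AMon (N + 1) F → AMon N F
  | 0, _, h => h.1
  | _ + 1, _, h => ⟨h.1, h.2.1, h.2.2.pred⟩

theorem AMon.of_hasDeriv {N : ℕ} {F F' : ℝ → ℝ} (h0 : ∀ s ∈ Set.Ioo (0:ℝ) 1, 0 ≤ F s)
    (h : ∀ s ∈ Set.Ioo (0:ℝ) 1, HasDerivAt F (F' s) s) (h' : AMon N F') : AMon (N + 1) F :=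
  ⟨h0, fun s hs => (h s hs).differentiableAt, AMon.congr N (fun s hs => (h s hs).deriv.symm) h'⟩

theorem AMon.add : ∀ (N : ℕ) {F G : ℝ → ℝ}, AMon N F → AMon N G → AMon N (fun s => F s + G s)
  | 0, _, _, hF, hG => fun s hs => add_nonneg (hF s hs) (hG s hs)
  | N + 1, F, G, hF, hG => AMon.of_hasDeriv (F' := fun s => deriv F s + deriv G s)
      (fun s hs => add_nonneg (hF.1 s hs) (hG.1 s hs))
      (fun s hs => (hF.2.1 s hs).hasDerivAt.add (hG.2.1 s hs).hasDerivAt)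
      (AMon.add N hF.2.2 hG.2.2)

theorem AMon.mul : ∀ (N : ℕ) {F G : ℝ → ℝ}, AMon N F → AMon N G → AMon N (fun s => F s * G s)
  | 0, _, _, hF, hG => fun s hs => mul_nonneg (hF s hs) (hG s hs)
  | N + 1, F, G, hF, hG => AMon.of_hasDeriv (F' := fun s => deriv F s * G s + F s * deriv G s)
      (fun s hs => mul_nonneg (hF.1 s hs) (hG.1 s hs))
      (fun s hs => (hF.2.1 s hs).hasDerivAt.mul (hG.2.1 s hs).hasDerivAt)
      (AMon.add N (AMon.mul N hF.2.2 hG.pred) (AMon.mul N hF.pred hG.2.2))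

theorem AMon.comp : ∀ (N : ℕ) {F G : ℝ → ℝ}, AMon N F → AMon N G →
    (∀ s ∈ Set.Ioo (0:ℝ) 1, G s ∈ Set.Ioo (0:ℝ) 1) → AMon N (fun s => F (G s))
  | 0, _, _, hF, _, h => fun s hs => hF _ (h s hs)
  | N + 1, F, G, hF, hG, h => AMon.of_hasDeriv (F' := fun s => deriv F (G s) * deriv G s)
      (fun s hs => hF.1 _ (h s hs))
      (fun s hs => (hF.2.1 _ (h s hs)).hasDerivAt.comp s (hG.2.1 s hs).hasDerivAt)
      (AMon.mul N (AMon.comp N hF.2.2 hG.pred h) hG.2.2)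

theorem AMon.iter : ∀ (j : ℕ) {N : ℕ} {F : ℝ → ℝ}, AMon (j + N) F → AMon N (iteratedDeriv j F)
  | 0, N, F, h => by simpa using h
  | j + 1, N, F, h => by
      rw [iteratedDeriv_succ']
      rw [show j + 1 + N = (j + N) + 1 by ring] at h
      exact AMon.iter j h.2.2

theorem AMon.id : ∀ N : ℕ, AMon N (fun s => s) := by
  have hc : ∀ N : ℕ, ∀ c : ℝ, 0 ≤ c → AMon N (fun _ => c) := by
    intro N
    induction N with
    | zero => intro c hc s hs; exact hc
    | succ N ih =>
      intro c hc
      exact AMon.of_hasDeriv (F' := fun _ => 0) (fun s hs => hc) (fun s hs => hasDerivAt_const s c)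
        (ih 0 le_rfl)
  intro N
  cases N with
  | zero => exact fun s hs => hs.1.le
  | succ N =>
    exact AMon.of_hasDeriv (F' := fun _ => 1) (fun s hs => hs.1.le) (fun s hs => hasDerivAt_id s)
        (hc N 1 zero_le_one)

theorem summable_poly_bound {q : ℕ → ℝ} {C : ℝ} {d : ℕ} (hq0 : ∀ k, 0 ≤ q k)
    (hq : ∀ k, q k ≤ C * ((k:ℝ) + 1) ^ d) {s : ℝ} (hs : s ∈ Set.Ioo (0:ℝ) 1) :
    Summable fun k => q k * s ^ k := by
  have h1 : Summable fun n : ℕ => (n:ℝ) ^ d * s ^ n :=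
    summable_pow_mul_geometric_of_norm_lt_one d (by
      rw [Real.norm_eq_abs, abs_of_pos hs.1]; exact hs.2)
  have h2 := ((summable_nat_add_iff 1).2 h1).mul_left (C / s)
  refine Summable.of_nonneg_of_le (fun k => mul_nonneg (hq0 k) (pow_nonneg hs.1.le k)) (fun k => ?_) h2
  have h3 : C / s * (((k + 1 : ℕ) : ℝ) ^ d * s ^ (k + 1)) = C * ((k:ℝ) + 1) ^ d * s ^ k := by
    have := hs.1.ne'
    push_cast; field_simp; ring
  rw [h3]
  exact mul_le_mul_of_nonneg_right (hq k) (pow_nonneg hs.1.le k)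

theorem AMon.series : ∀ (N : ℕ) {q : ℕ → ℝ} {C : ℝ} {d : ℕ}, (∀ k, 0 ≤ q k) → 
    (∀ k, q k ≤ C * ((k:ℝ) + 1) ^ d) → AMon N (fun s => ∑' k, q k * s ^ k)
  | 0, q, C, d, hq0, hq => fun s hs => tsum_nonneg fun k => mul_nonneg (hq0 k) (pow_nonneg hs.1.le k)
  | N + 1, q, C, d, hq0, hq => by
    have hC : 0 ≤ C := by simpa using (hq0 0).trans (hq 0)
    have hq0' : ∀ k : ℕ, 0 ≤ ((k:ℝ) + 1) * q (k + 1) := fun k => mul_nonneg (by positivity) (hq0 _)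
    have hq' : ∀ k : ℕ, ((k:ℝ) + 1) * q (k + 1) ≤ (C * 2 ^ d) * ((k:ℝ) + 1) ^ (d + 1) := by
      intro k
      have h1 := hq (k + 1)
      push_cast at h1
      have h2 : ((k:ℝ) + 1 + 1) ^ d ≤ (2 * ((k:ℝ) + 1)) ^ d :=
        pow_le_pow_left₀ (by positivity) (by have : (0:ℝ) ≤ k := by positivity
                                             linarith) d
      have h3 : q (k + 1) ≤ C * (2 * ((k:ℝ) + 1)) ^ d :=
        h1.trans (mul_le_mul_of_nonneg_left h2 hC)
      calc ((k:ℝ) + 1) * q (k + 1) ≤ ((k:ℝ) + 1) * (C * (2 * ((k:ℝ) + 1)) ^ d) :=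
            mul_le_mul_of_nonneg_left h3 (by positivity)
        _ = _ := by rw [mul_pow]; ring
    refine AMon.of_hasDeriv (F' := fun s => ∑' k : ℕ, (((k:ℝ) + 1) * q (k + 1)) * s ^ k)
      (fun s hs => tsum_nonneg fun k => mul_nonneg (hq0 k) (pow_nonneg hs.1.le k)) ?_
      (AMon.series N hq0' hq')
    intro s hs
    obtain ⟨r, hr1, hr2⟩ := exists_between hs.2
    have hr : r ∈ Set.Ioo (0:ℝ) 1 := ⟨hs.1.trans hr1, hr2⟩
    have hsum : ∀ t ∈ Set.Ioo (0:ℝ) 1, Summable fun k : ℕ => q k * ((k:ℝ) * t ^ (k - 1)) := by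
      intro t ht
      rw [← summable_nat_add_iff 1]
      refine (summable_poly_bound hq0' hq' ht).congr fun k => ?_
      push_cast
      ring
    have key := hasDerivAt_tsum_of_isPreconnected (g := fun k s => q k * s ^ k)
      (g' := fun k s => q k * ((k:ℝ) * s ^ (k - 1))) (hsum r hr) (t := Set.Ioo 0 r) (y₀ := s) (y := s)
      isOpen_Ioo (convex_Ioo 0 r).isPreconnected
      (fun k y _ => (hasDerivAt_pow k y).const_mul (q k))
      (fun k y hy => by
        rw [Real.norm_eq_abs, abs_of_nonneg (mul_nonneg (hq0 k) (mul_nonneg (by positivity) (pow_nonneg hy.1.le _)))]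
        exact mul_le_mul_of_nonneg_left (mul_le_mul_of_nonneg_left
          (pow_le_pow_left₀ hy.1.le hy.2.le _) (by positivity)) (hq0 k))
      ⟨hs.1, hr1⟩ (summable_poly_bound hq0 hq hs) ⟨hs.1, hr1⟩
    suffices e : ∑' k : ℕ, (((k:ℝ) + 1) * q (k + 1)) * s ^ k =
        ∑' k : ℕ, q k * ((k:ℝ) * s ^ (k - 1)) by
      beta_reduce; rw [e]; exact key
    rw [(hsum s hs).tsum_eq_zero_add]
    simp only [Nat.cast_zero, zero_mul, mul_zero, zero_add]
    refine tsum_congr fun k => ?_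
    push_cast
    ring

theorem tendsto_sandwich_eps {u : ℕ → ℝ} {L : ℝ}
    (h1 : ∀ c < L, ∃ l : ℕ → ℝ, ∃ a, c < a ∧ Tendsto l atTop (𝓝 a) ∧ ∀ᶠ n in atTop, l n ≤ u n)
    (h2 : ∀ c > L, ∃ l : ℕ → ℝ, ∃ a, a < c ∧ Tendsto l atTop (𝓝 a) ∧ ∀ᶠ n in atTop, u n ≤ l n) :
    Tendsto u atTop (𝓝 L) := by
  rw [tendsto_order]
  constructor
  · intro c hc
    obtain ⟨l, a, ha, hl, h⟩ := h1 c hc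
    filter_upwards [h, hl.eventually_const_lt ha] with n h3 h4 using h4.trans_le h3
  · intro c hc
    obtain ⟨l, a, ha, hl, h⟩ := h2 c hc
    filter_upwards [h, hl.eventually_lt_const ha] with n h3 h4 using h3.trans_lt h4

theorem tendsto_moving {α β v : ℝ} {H : ℕ → ℝ → ℝ} {G : ℝ → ℝ} {w : ℕ → ℝ} (hv : v ∈ Set.Ioo α β)
    (hH : ∀ᶠ n in atTop, MonotoneOn (H n) (Set.Ioo α β))
    (hG : ContinuousAt G v)
    (hlim : ∀ t ∈ Set.Ioo α β, Tendsto (fun n => H n t) atTop (𝓝 (G t)))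
    (hw : Tendsto w atTop (𝓝 v)) : Tendsto (fun n => H n (w n)) atTop (𝓝 (G v)) := by
  have hwm : ∀ᶠ n in atTop, w n ∈ Set.Ioo α β := hw (isOpen_Ioo.mem_nhds hv)
  apply tendsto_sandwich_eps
  · intro c hc
    have h1 : ∀ᶠ t in 𝓝[<] v, c < G t ∧ t ∈ Set.Ioo α β ∧ t < v :=
      ((hG.eventually_const_lt hc).filter_mono nhdsWithin_le_nhds).and
        (Filter.inter_mem (mem_nhdsWithin_of_mem_nhds (isOpen_Ioo.mem_nhds hv))
          self_mem_nhdsWithin)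
    obtain ⟨t, ht1, ht2, ht3⟩ := h1.exists
    refine ⟨_, _, ht1, hlim t ht2, ?_⟩
    filter_upwards [hH, hwm, hw.eventually_const_lt ht3] with n a1 a2 a3 using a1 ht2 a2 a3.le
  · intro c hc
    have h1 : ∀ᶠ t in 𝓝[>] v, G t < c ∧ t ∈ Set.Ioo α β ∧ v < t :=
      ((hG.eventually_lt_const hc).filter_mono nhdsWithin_le_nhds).and
        (Filter.inter_mem (mem_nhdsWithin_of_mem_nhds (isOpen_Ioo.mem_nhds hv))
          self_mem_nhdsWithin)
    obtain ⟨t, ht1, ht2, ht3⟩ := h1.exists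
    refine ⟨_, _, ht1, hlim t ht2, ?_⟩
    filter_upwards [hH, hwm, hw.eventually_lt_const ht3] with n a1 a2 a3 using a1 a2 ht2 a3.le

theorem slope_bounds {α β : ℝ} {F F' : ℝ → ℝ} (hd : ∀ t ∈ Set.Ioo α β, HasDerivAt F (F' t) t)
    (hm : MonotoneOn F' (Set.Ioo α β)) {a b : ℝ} (ha : a ∈ Set.Ioo α β) (hb : b ∈ Set.Ioo α β)
    (hab : a < b) : F' a ≤ slope F a b ∧ slope F a b ≤ F' b := by
  have hsub : Set.Icc a b ⊆ Set.Ioo α β := fun t ht => ⟨ha.1.trans_le ht.1, ht.2.trans_lt hb.2⟩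
  obtain ⟨c, hc, h⟩ := exists_hasDerivAt_eq_slope F F' hab
    (fun t ht => (hd t (hsub ht)).continuousAt.continuousWithinAt)
    (fun t ht => hd t (hsub (Set.Ioo_subset_Icc_self ht)))
  rw [slope_def_field, ← h]
  have hc' := hsub (Set.Ioo_subset_Icc_self hc)
  exact ⟨hm ha hc' hc.1.le, hm hc' hb hc.2.le⟩

theorem tendsto_deriv_of_mono {α β v : ℝ} {H H' : ℕ → ℝ → ℝ} {G : ℝ → ℝ} {g : ℝ}
    (hv : v ∈ Set.Ioo α β)
    (hd : ∀ᶠ n in atTop, ∀ t ∈ Set.Ioo α β, HasDerivAt (H n) (H' n t) t)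
    (hm : ∀ᶠ n in atTop, MonotoneOn (H' n) (Set.Ioo α β))
    (hlim : ∀ t ∈ Set.Ioo α β, Tendsto (fun n => H n t) atTop (𝓝 (G t)))
    (hG : HasDerivAt G g v) : Tendsto (fun n => H' n v) atTop (𝓝 g) := by
  have hs := hasDerivAt_iff_tendsto_slope.1 hG
  have hsl : ∀ t ∈ Set.Ioo α β, Tendsto (fun n => slope (H n) v t) atTop (𝓝 (slope G v t)) := by
    intro t ht
    simp only [slope_def_field]
    exact ((hlim t ht).sub (hlim v hv)).div_const _
  apply tendsto_sandwich_eps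
  · intro c hc
    have h1 : ∀ᶠ t in 𝓝[<] v, c < slope G v t ∧ t ∈ Set.Ioo α β ∧ t < v :=
      ((hs.eventually_const_lt hc).filter_mono (nhdsWithin_mono _ fun t ht => ne_of_lt ht)).and
        (Filter.inter_mem (mem_nhdsWithin_of_mem_nhds (isOpen_Ioo.mem_nhds hv))
          self_mem_nhdsWithin)
    obtain ⟨t, ht1, ht2, ht3⟩ := h1.exists
    refine ⟨_, _, ht1, hsl t ht2, ?_⟩
    filter_upwards [hd, hm] with n a1 a2
    rw [slope_comm]
    exact (slope_bounds a1 a2 ht2 hv ht3).2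
  · intro c hc
    have h1 : ∀ᶠ t in 𝓝[>] v, slope G v t < c ∧ t ∈ Set.Ioo α β ∧ v < t :=
      ((hs.eventually_lt_const hc).filter_mono (nhdsWithin_mono _ fun t ht => ne_of_gt ht)).and
        (Filter.inter_mem (mem_nhdsWithin_of_mem_nhds (isOpen_Ioo.mem_nhds hv))
          self_mem_nhdsWithin)
    obtain ⟨t, ht1, ht2, ht3⟩ := h1.exists
    refine ⟨_, _, ht1, hsl t ht2, ?_⟩
    filter_upwards [hd, hm] with n a1 a2
    exact (slope_bounds a1 a2 hv ht2 ht3).1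

/-- second-order remainder polynomial -/
noncomputable def remPoly (k : ℕ) (s : ℝ) : ℝ :=
  ∑ i ∈ Finset.range k, ∑ l ∈ Finset.range i, s ^ l

theorem remPoly_id (k : ℕ) (s : ℝ) : s ^ k = 1 - k * (1 - s) + (1 - s) ^ 2 * remPoly k s := by
  induction k with
  | zero => simp [remPoly]
  | succ k ih =>
    have h1 : remPoly (k + 1) s = remPoly k s + ∑ l ∈ Finset.range k, s ^ l := by
      simp [remPoly, Finset.sum_range_succ]
    have h2 := mul_neg_geom_sum s k
    rw [h1]
    push_cast
    have : (1 - s) ^ 2 * (remPoly k s + ∑ l ∈ Finset.range k, s ^ l)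
      = (s ^ k - (1 - k * (1 - s))) + (1 - s) * (1 - s ^ k) := by
      rw [← h2]; linear_combination -ih
    rw [this]; ring

theorem remPoly_nonneg (k : ℕ) {s : ℝ} (hs : 0 ≤ s) : 0 ≤ remPoly k s :=
  Finset.sum_nonneg fun i _ => Finset.sum_nonneg fun l _ => pow_nonneg hs l

theorem remPoly_one (k : ℕ) : remPoly k 1 = ((k:ℝ) ^ 2 - k) / 2 := by
  induction k with
  | zero => simp [remPoly]
  | succ k ih =>
    have h1 : remPoly (k + 1) 1 = remPoly k 1 + k := by
      simp [remPoly, Finset.sum_range_succ]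
    rw [h1, ih]; push_cast; ring

theorem remPoly_le (k : ℕ) {s : ℝ} (hs : 0 ≤ s) (hs1 : s ≤ 1) : remPoly k s ≤ remPoly k 1 :=
  Finset.sum_le_sum fun _ _ => Finset.sum_le_sum fun l _ => pow_le_pow_left₀ hs hs1 l

theorem one_le_remPoly {k : ℕ} (hk : 2 ≤ k) {s : ℝ} (hs : 0 ≤ s) : 1 ≤ remPoly k s := by
  have h := Finset.single_le_sum (f := fun i => ∑ l ∈ Finset.range i, s ^ l)
    (s := Finset.range k) (fun i _ => Finset.sum_nonneg fun l _ => pow_nonneg hs l)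
    (Finset.mem_range.2 (show 1 < k by omega))
  simpa [remPoly] using h

theorem pgf_basic (p : ℕ → ℝ) (hp0 : ∀ k, 0 ≤ p k) (hp1 : ∑' k, p k = 1)
    (hmean : ∑' k : ℕ, (k : ℝ) * p k = 1) (B : ℝ) (hB : 0 < B)
    (hsq : Summable fun k : ℕ => (k : ℝ) ^ 2 * p k)
    (hvar : (∑' k : ℕ, (k : ℝ) ^ 2 * p k) - 1 = 2 * B) :
    ∃ R : ℝ → ℝ, ∃ c > 0, (∀ s ∈ Set.Icc (0:ℝ) 1, pgf p s = s + (1 - s) ^ 2 * R s) ∧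
      (∀ s ∈ Set.Icc (0:ℝ) 1, c ≤ R s) ∧ Tendsto R (𝓝[Set.Icc 0 1] 1) (𝓝 B) ∧
      (∀ s ∈ Set.Ico (0:ℝ) 1, pgf p s < 1) := by
  have hsp : Summable p := by
    by_contra h
    rw [tsum_eq_zero_of_not_summable h] at hp1; norm_num at hp1
  have hsk : Summable fun k : ℕ => (k:ℝ) * p k := by
    by_contra h
    rw [tsum_eq_zero_of_not_summable h] at hmean; norm_num at hmean
  obtain ⟨k₀, hk₀, hpk⟩ : ∃ k, 2 ≤ k ∧ 0 < p k := by
    by_contra! h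
    have : ∀ k : ℕ, (k:ℝ) ^ 2 * p k = k * p k := by
      intro k
      by_cases hk : 2 ≤ k
      · rw [le_antisymm (h k hk) (hp0 k)]; simp
      · interval_cases k <;> simp
    rw [tsum_congr this, hmean] at hvar
    linarith
  have hs1 : Summable fun k : ℕ => p k * remPoly k 1 := by
    refine ((hsq.sub hsk).div_const 2).congr fun k => ?_
    rw [remPoly_one]; ring
  have hsr : ∀ s ∈ Set.Icc (0:ℝ) 1, Summable fun k : ℕ => p k * remPoly k s := fun s hs =>
    Summable.of_nonneg_of_le (fun k => mul_nonneg (hp0 k) (remPoly_nonneg k hs.1))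
      (fun k => mul_le_mul_of_nonneg_left (remPoly_le k hs.1 hs.2) (hp0 k)) hs1
  refine ⟨fun s => ∑' k, p k * remPoly k s, p k₀, hpk, ?_, ?_, ?_, ?_⟩
  · intro s hs
    have h : HasSum (fun k => p k * s ^ k)
        (1 - 1 * (1 - s) + (1 - s) ^ 2 * ∑' k, p k * remPoly k s) := by
      have e1 := hsp.hasSum
      have e2 := hsk.hasSum.mul_right (1 - s)
      have e3 := (hsr s hs).hasSum.mul_left ((1 - s) ^ 2)
      rw [hp1] at e1
      rw [hmean] at e2
      refine ((e1.sub e2).add e3).congr_fun ?_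
      intro k
      rw [remPoly_id k s]; ring
    rw [pgf, h.tsum_eq]; ring
  · intro s hs
    refine le_trans ?_ ((hsr s hs).le_tsum k₀ fun k _ => mul_nonneg (hp0 k) (remPoly_nonneg k hs.1))
    exact le_mul_of_one_le_right (hp0 _) (one_le_remPoly hk₀ hs.1)
  · have hlim : ∑' k, p k * remPoly k 1 = B := by
      have : ∀ k : ℕ, p k * remPoly k 1 = ((k:ℝ) ^ 2 * p k - k * p k) / 2 := by
        intro k; rw [remPoly_one]; ring
      rw [tsum_congr this, tsum_div_const, hsq.tsum_sub hsk, hmean]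
      linarith
    rw [← hlim]
    refine tendsto_tsum_of_dominated_convergence hs1 ?_ ?_
    · intro k
      have : Continuous fun s => p k * remPoly k s := by
        unfold remPoly; fun_prop
      exact (this.tendsto 1).mono_left nhdsWithin_le_nhds
    · filter_upwards [self_mem_nhdsWithin] with s hs k
      rw [Real.norm_eq_abs, abs_of_nonneg (mul_nonneg (hp0 k) (remPoly_nonneg k hs.1))]
      exact mul_le_mul_of_nonneg_left (remPoly_le k hs.1 hs.2) (hp0 k)
  · intro s hs
    rw [← hp1, pgf]
    have hle : ∀ k, p k * s ^ k ≤ p k := fun k =>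
      mul_le_of_le_one_right (hp0 k) (pow_le_one₀ hs.1 hs.2.le)
    refine Summable.tsum_lt_tsum (i := k₀) hle ?_ ?_ hsp
    · exact mul_lt_of_lt_one_right hpk (pow_lt_one₀ hs.1 hs.2 (by omega))
    · exact Summable.of_nonneg_of_le (fun k => mul_nonneg (hp0 k) (pow_nonneg hs.1 k)) hle hsp

theorem pgfIter_add (p : ℕ → ℝ) (m k : ℕ) (s : ℝ) :
    pgfIter p (m + k) s = pgfIter p m (pgfIter p k s) := by
  induction m with
  | zero => simp [pgfIter]
  | succ m ih => rw [show m + 1 + k = (m + k) + 1 by ring]; simp only [pgfIter]; rw [ih]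

theorem pgfIter_facts (p : ℕ → ℝ) (hp0 : ∀ k, 0 ≤ p k) (hp1 : ∑' k, p k = 1)
    (hmean : ∑' k : ℕ, (k : ℝ) * p k = 1) (B : ℝ) (hB : 0 < B)
    (hsq : Summable fun k : ℕ => (k : ℝ) ^ 2 * p k)
    (hvar : (∑' k : ℕ, (k : ℝ) ^ 2 * p k) - 1 = 2 * B) :
    (∀ n, pgfIter p n 0 ∈ Set.Ico (0:ℝ) 1) ∧ (∀ N m, AMon N (pgfIter p m)) ∧
    Tendsto (fun n => 1 / (1 - pgfIter p (n + 1) 0) - 1 / (1 - pgfIter p n 0)) atTop (𝓝 B) := by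
  obtain ⟨R, c, hc, h1, h2, h3, h4⟩ := pgf_basic p hp0 hp1 hmean B hB hsq hvar
  have hsp : Summable p := by
    by_contra h
    rw [tsum_eq_zero_of_not_summable h] at hp1; norm_num at hp1
  have hge : ∀ s ∈ Set.Icc (0:ℝ) 1, s ≤ pgf p s := by
    intro s hs
    rw [h1 s hs]
    have := h2 s hs
    have : 0 ≤ (1 - s) ^ 2 * R s := mul_nonneg (sq_nonneg _) (by linarith)
    linarith
  have hI : ∀ n, pgfIter p n 0 ∈ Set.Ico (0:ℝ) 1 := by
    intro n
    induction n with
    | zero => simp [pgfIter]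
    | succ n ih => exact ⟨ih.1.trans (hge _ ⟨ih.1, ih.2.le⟩), h4 _ ih⟩
  refine ⟨hI, ?_, ?_⟩
  · have hmap : ∀ m, ∀ s ∈ Set.Ioo (0:ℝ) 1, pgfIter p m s ∈ Set.Ioo (0:ℝ) 1 := by
      intro m s hs
      induction m with
      | zero => exact hs
      | succ m ih => exact ⟨ih.1.trans_le (hge _ ⟨ih.1.le, ih.2.le⟩), h4 _ ⟨ih.1.le, ih.2⟩⟩
    intro N m
    induction m with
    | zero => exact AMon.id N
    | succ m ih =>
      have hf : AMon N (pgf p) := by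
        refine AMon.series N (C := 1) (d := 0) hp0 (fun k => ?_)
        rw [pow_zero, mul_one, ← hp1]
        exact hsp.le_tsum k fun i _ => hp0 i
      exact AMon.comp N (F := pgf p) (G := pgfIter p m) hf ih (hmap m)
  · set a : ℕ → ℝ := fun n => 1 - pgfIter p n 0 with ha
    have hapos : ∀ n, 0 < a n := fun n => by have := (hI n).2; simp only [ha]; linarith
    have hrec : ∀ n, a (n + 1) = a n - a n ^ 2 * R (pgfIter p n 0) := by
      intro n
      have := h1 _ ⟨(hI n).1, (hI n).2.le⟩
      simp only [ha, pgfIter]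
      rw [this]; ring
    have hR : ∀ n, c ≤ R (pgfIter p n 0) := fun n => h2 _ ⟨(hI n).1, (hI n).2.le⟩
    have hanti : Antitone a := antitone_nat_of_succ_le fun n => by
      rw [hrec]
      have : 0 ≤ a n ^ 2 * R (pgfIter p n 0) := mul_nonneg (sq_nonneg _) (hc.le.trans (hR n))
      linarith
    have hbdd : BddBelow (Set.range a) := ⟨0, by rintro _ ⟨n, rfl⟩; exact (hapos n).le⟩
    have hL := tendsto_atTop_ciInf hanti hbdd
    set L := ⨅ n, a n
    have hL' : L ≤ L - L ^ 2 * c := by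
      refine le_of_tendsto_of_tendsto' (hL.comp (tendsto_add_atTop_nat 1))
        (hL.sub ((hL.pow 2).mul_const c)) fun n => ?_
      simp only [Function.comp]
      rw [hrec]
      have := mul_le_mul_of_nonneg_left (hR n) (sq_nonneg (a n))
      linarith
    have hL0 : L = 0 := by
      have h5 : L ^ 2 * c ≤ 0 := by linarith
      have h6 : 0 ≤ L ^ 2 := sq_nonneg L
      have : L ^ 2 = 0 := by nlinarith
      simpa using this
    rw [hL0] at hL
    have hfs : Tendsto (fun n => pgfIter p n 0) atTop (𝓝[Set.Icc 0 1] 1) := by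
      refine tendsto_nhdsWithin_iff.2 ⟨?_, Eventually.of_forall fun n => ⟨(hI n).1, (hI n).2.le⟩⟩
      have := hL.const_sub 1
      simpa [ha] using this
    have hRl := h3.comp hfs
    have hlim : Tendsto (fun n => R (pgfIter p n 0) / (1 - a n * R (pgfIter p n 0))) atTop (𝓝 B) := by
      have := hRl.div ((hL.mul hRl).const_sub 1) (by simp)
      simp only [zero_mul, sub_zero, div_one] at this
      exact this
    refine hlim.congr fun n => ?_
    change _ = 1 / a (n + 1) - 1 / a n
    have e1 := hapos n
    have e2 := hapos (n + 1)
    have e3 : a (n + 1) = a n * (1 - a n * R (pgfIter p n 0)) := by rw [hrec]; ring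
    have e4 : 1 - a n * R (pgfIter p n 0) ≠ 0 := by
      intro h; rw [h] at e3; simp at e3; exact e2.ne' e3
    rw [e3]
    have := e1.ne'
    generalize R (pgfIter p n 0) = r at *
    rw [div_sub_div _ _ (mul_ne_zero this e4) this, div_eq_div_iff e4 (mul_ne_zero (mul_ne_zero this e4) this)]
    ring

theorem b_div {b : ℕ → ℝ} {B : ℝ} (h : Tendsto (fun n => b (n + 1) - b n) atTop (𝓝 B)) :
    Tendsto (fun n => b n / n) atTop (𝓝 B) := by
  have h1 := h.cesaro
  have h2 : Tendsto (fun n : ℕ => b 0 / (n:ℝ)) atTop (𝓝 0) :=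
    tendsto_const_nhds.div_atTop tendsto_natCast_atTop_atTop
  have h3 := h1.add h2
  rw [add_zero] at h3
  refine h3.congr fun n => ?_
  rw [Finset.sum_range_sub]; ring

theorem b_incr {b : ℕ → ℝ} {B lam : ℝ} (h : Tendsto (fun n => b (n + 1) - b n) atTop (𝓝 B))
    {m l : ℕ → ℕ} {k : ℕ → ℝ} (hm : Tendsto m atTop atTop) (hk : Tendsto k atTop atTop)
    (hl : Tendsto (fun n => (l n : ℝ) / k n) atTop (𝓝 lam)) :
    Tendsto (fun n => (b (m n + l n) - b (m n)) / k n) atTop (𝓝 (B * lam)) := by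
  have ho : (fun n => b (m n + l n) - b (m n) - B * l n) =o[atTop] fun n => (l n : ℝ) := by
    rw [isLittleO_iff]
    intro ε hε
    have h1 := (Metric.tendsto_atTop.1 h) ε hε
    obtain ⟨N, hN⟩ := h1
    filter_upwards [hm.eventually_ge_atTop N] with n hn
    have : ∀ t : ℕ, ‖b (m n + t) - b (m n) - B * t‖ ≤ ε * t := by
      intro t
      induction t with
      | zero => simp
      | succ t ih =>
        have h2 := hN (m n + t) (by omega)
        rw [Real.dist_eq] at h2
        rw [Real.norm_eq_abs] at *
        rw [abs_le] at *
        rw [abs_lt] at h2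
        push_cast
        rw [← add_assoc]
        constructor <;> linarith
    rw [Real.norm_eq_abs (l n : ℝ), Nat.abs_cast]
    exact this _
  have hO : (fun n => (l n : ℝ)) =O[atTop] k := by
    refine isBigO_of_div_tendsto_nhds ?_ lam hl
    filter_upwards [hk.eventually_gt_atTop 0] with n hn h0
    exact absurd h0 hn.ne'
  have h0 := (ho.trans_isBigO hO).tendsto_div_nhds_zero
  have h5 := h0.add (hl.const_mul B)
  rw [zero_add] at h5
  refine h5.congr fun n => ?_
  ring

theorem AMon.monotoneOn {F : ℝ → ℝ} (h : AMon 1 F) : MonotoneOn F (Set.Ioo 0 1) := by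
  refine monotoneOn_of_deriv_nonneg (convex_Ioo 0 1)
    (fun s hs => (h.2.1 s hs).continuousAt.continuousWithinAt) ?_ ?_
  · rw [interior_Ioo]; exact fun s hs => (h.2.1 s hs).differentiableWithinAt
  · rw [interior_Ioo]; exact h.2.2

section main

variable {f : ℕ → ℝ → ℝ} {B : ℝ} {k : ℕ → ℕ}

theorem step_zero (hB : 0 < B) (hI : ∀ n, f n 0 ∈ Set.Ico (0:ℝ) 1)
    (hadd : ∀ m l s, f (m + l) s = f m (f l s))
    (hb : Tendsto (fun n => 1 / (1 - f (n + 1) 0) - 1 / (1 - f n 0)) atTop (𝓝 B))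
    (hk : Tendsto k atTop atTop) (hkn : Tendsto (fun n : ℕ => (k n : ℝ) / n) atTop (𝓝 0))
    {lam : ℝ} (hlam : 0 < lam) :
    Tendsto (fun n => B * k n * (f ⌊lam * k n⌋₊ 0 - 1)) atTop (𝓝 (-(1 / lam))) ∧
    Tendsto (fun n : ℕ => B * (n:ℝ) ^ 2 / k n * (f (n - k n) (f ⌊lam * k n⌋₊ 0) - f n 0)) atTop
      (𝓝 (lam - 1)) := by
  set b : ℕ → ℝ := fun n => 1 / (1 - f n 0) with hbdef
  have hapos : ∀ n, 0 < 1 - f n 0 := fun n => by have := (hI n).2; linarith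
  have hkR : Tendsto (fun n => (k n : ℝ)) atTop atTop := tendsto_natCast_atTop_atTop.comp hk
  have hbd : Tendsto (fun n => b n / n) atTop (𝓝 B) := b_div hb
  have hal : Tendsto (fun n : ℕ => (n:ℝ) * (1 - f n 0)) atTop (𝓝 B⁻¹) := by
    refine (hbd.inv₀ hB.ne').congr fun n => ?_
    simp [hbdef]
  have hfl : Tendsto (fun n => (⌊lam * k n⌋₊ : ℝ) / k n) atTop (𝓝 lam) :=
    (tendsto_nat_floor_mul_div_atTop hlam.le).comp hkR
  have hfltop : Tendsto (fun n => ⌊lam * k n⌋₊) atTop atTop :=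
    tendsto_nat_floor_atTop.comp (hkR.const_mul_atTop hlam)
  have hkpos : ∀ᶠ n in atTop, (0:ℝ) < k n := hkR.eventually_gt_atTop 0
  have hle : ∀ᶠ n in atTop, k n ≤ n := by
    filter_upwards [hkn.eventually_lt_const zero_lt_one, eventually_gt_atTop 0] with n h1 h2
    have : (0:ℝ) < n := by exact_mod_cast h2
    rw [div_lt_one this] at h1
    exact_mod_cast h1.le
  constructor
  · have h1 := ((hal.comp hfltop).div hfl hlam.ne').const_mul (-B)
    have e : -B * (B⁻¹ / lam) = -(1 / lam) := by field_simp
    rw [e] at h1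
    refine h1.congr' ?_
    filter_upwards [hkpos, hfltop.eventually_gt_atTop 0] with n h2 h3
    have h4 : (⌊lam * k n⌋₊ : ℝ) ≠ 0 := by positivity
    simp only [Function.comp, Pi.div_apply]
    field_simp
    ring
  · set N : ℕ → ℕ := fun n => (n - k n) + ⌊lam * k n⌋₊ with hN
    have hmr : Tendsto (fun n : ℕ => ((n - k n : ℕ) : ℝ) / n) atTop (𝓝 1) := by
      have := hkn.const_sub 1
      rw [sub_zero] at this
      refine this.congr' ?_
      filter_upwards [hle, eventually_gt_atTop 0] with n h1 h2
      have : (n:ℝ) ≠ 0 := by positivity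
      rw [Nat.cast_sub h1]; field_simp
    have hNr : Tendsto (fun n : ℕ => (N n : ℝ) / n) atTop (𝓝 1) := by
      have := hmr.add (hfl.mul hkn)
      rw [mul_zero, add_zero] at this
      refine this.congr' ?_
      filter_upwards [hkpos, eventually_gt_atTop 0] with n h1 h2
      have : (n:ℝ) ≠ 0 := by positivity
      simp only [hN]; push_cast; field_simp
    have hmtop : Tendsto (fun n => n - k n) atTop atTop := by
      have : Tendsto (fun n : ℕ => ((n - k n : ℕ) : ℝ)) atTop atTop := by
        have := hmr.pos_mul_atTop zero_lt_one tendsto_natCast_atTop_atTop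
        refine this.congr' ?_
        filter_upwards [eventually_gt_atTop 0] with n h2
        have : (n:ℝ) ≠ 0 := by positivity
        field_simp
      exact tendsto_natCast_atTop_iff.1 this
    have hNtop : Tendsto N atTop atTop :=
      tendsto_atTop_mono (fun n => Nat.le_add_right _ _) hmtop
    have i1 := b_incr (b := b) hb hmtop hkR hfl
    have hkk : Tendsto (fun n => (k n : ℝ) / k n) atTop (𝓝 1) := by
      refine tendsto_const_nhds.congr' ?_
      filter_upwards [hkpos] with n h
      rw [div_self h.ne']
    have i2 := b_incr (b := b) hb hmtop hkR hkk
    have i3 : Tendsto (fun n : ℕ => (n:ℝ) * (1 - f (N n) 0)) atTop (𝓝 B⁻¹) := by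
      have := (hal.comp hNtop).div hNr one_ne_zero
      rw [div_one] at this
      refine this.congr' ?_
      filter_upwards [hNtop.eventually_gt_atTop 0, eventually_gt_atTop 0] with n h1 h2
      have : (n:ℝ) ≠ 0 := by positivity
      have : (N n:ℝ) ≠ 0 := by positivity
      simp only [Function.comp, Pi.div_apply]; field_simp
    have i4 := (((i1.sub i2).const_mul B).mul hal).mul i3
    have e : B * (B * lam - B * 1) * B⁻¹ * B⁻¹ = lam - 1 := by field_simp
    rw [e] at i4
    refine i4.congr' ?_
    filter_upwards [hle, hkpos] with n h1 h2
    rw [← hadd]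
    change B * ((b (N n) - _) / _ - _) * _ * _ = B * (n:ℝ) ^ 2 / k n * (f (N n) 0 - f n 0)
    rw [Nat.sub_add_cancel h1]
    have p1 := (hapos (N n)).ne'
    have p2 := (hapos n).ne'
    have e2 : (b (N n) - b (n - k n)) / (k n:ℝ) - (b n - b (n - k n)) / k n
      = (b (N n) - b n) / k n := by ring
    rw [e2]
    have e3 : b (N n) - b n = (f (N n) 0 - f n 0) / ((1 - f n 0) * (1 - f (N n) 0)) := by
      simp only [hbdef]
      rw [div_sub_div _ _ p1 p2, div_eq_div_iff (mul_ne_zero p1 p2) (mul_ne_zero p2 p1)]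
      ring
    rw [e3]
    field_simp

theorem arg_mem (hB : 0 < B) (hk : Tendsto k atTop atTop) (V : ℝ) :
    ∀ᶠ n in atTop, 0 < B * k n ∧ ∀ v ∈ Set.Ioo V 0, 1 + v / (B * k n) ∈ Set.Ioo (0:ℝ) 1 := by
  have hkR : Tendsto (fun n => B * (k n : ℝ)) atTop atTop :=
    (tendsto_natCast_atTop_atTop.comp hk).const_mul_atTop hB
  filter_upwards [hkR.eventually_gt_atTop 0, hkR.eventually_gt_atTop (-V)] with n h1 h2
  refine ⟨h1, fun v hv => ⟨?_, ?_⟩⟩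
  · have : -1 < v / (B * k n) := by
      rw [lt_div_iff₀ h1]; linarith [hv.1]
    linarith
  · have := div_neg_of_neg_of_pos hv.2 h1
    linarith

theorem step_one (hB : 0 < B) (hI : ∀ n, f n 0 ∈ Set.Ico (0:ℝ) 1)
    (hadd : ∀ m l s, f (m + l) s = f m (f l s)) (hA : ∀ N m, AMon N (f m))
    (hb : Tendsto (fun n => 1 / (1 - f (n + 1) 0) - 1 / (1 - f n 0)) atTop (𝓝 B))
    (hk : Tendsto k atTop atTop) (hkn : Tendsto (fun n : ℕ => (k n : ℝ) / n) atTop (𝓝 0))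
    {v : ℝ} (hv : v < 0) :
    Tendsto (fun n : ℕ => B * (n:ℝ) ^ 2 / k n * (f (n - k n) (1 + v / (B * k n)) - f n 0)) atTop
      (𝓝 (-(1 / v) - 1)) := by
  have hv' : 0 < -(1 / v) := by rw [neg_pos]; exact one_div_neg.2 hv
  have hmem : ∀ lam : ℝ, 0 < lam → ∀ᶠ n in atTop, f ⌊lam * k n⌋₊ 0 ∈ Set.Ioo (0:ℝ) 1 := by
    intro lam hlam
    have h0 := (step_zero hB hI hadd hb hk hkn hlam).1
    have : -(1 / lam) - 1 < -(1 / lam) := by linarith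
    filter_upwards [h0.eventually_const_lt this, arg_mem hB hk (-(1 / lam) - 2)] with n h1 h2
    refine ⟨?_, (hI _).2⟩
    have h3 := (h2.2 (-(1 / lam) - 1) ⟨by linarith, by have : 0 < 1 / lam := by positivity
                                                       linarith⟩).1
    have h4 : (-(1 / lam) - 1) / (B * k n) < f ⌊lam * k n⌋₊ 0 - 1 := by
      rw [div_lt_iff₀ h2.1]; linarith
    linarith
  apply tendsto_sandwich_eps
  · intro c hc
    obtain ⟨lam, h1, h2⟩ := exists_between (show max (c + 1) 0 < -(1 / v) from
      max_lt (by linarith) hv')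
    have hlam : 0 < lam := (le_max_right _ _).trans_lt h1
    have hcl : c + 1 < lam := (le_max_left _ _).trans_lt h1
    have hs := step_zero hB hI hadd hb hk hkn hlam
    refine ⟨_, _, by linarith, hs.2, ?_⟩
    have hlt : -(1 / lam) < v := by
      have h3 : lam * (-v) < 1 := by
        have := mul_lt_mul_of_pos_right h2 (neg_pos.2 hv)
        have e : -(1 / v) * -v = 1 := by field_simp [hv.ne]
        linarith
      have h4 : -v < 1 / lam := by rw [lt_div_iff₀ hlam]; linarith
      linarith
    filter_upwards [hmem lam hlam, arg_mem hB hk (v - 1), hs.1.eventually_lt_const hlt]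
      with n a1 a2 a3
    refine mul_le_mul_of_nonneg_left (sub_le_sub_right ?_ _) (by positivity)
    refine (hA 1 _).monotoneOn a1 (a2.2 v ⟨by linarith, hv⟩) ?_
    have h4 : f ⌊lam * k n⌋₊ 0 - 1 < v / (B * k n) := by
      rw [lt_div_iff₀ a2.1]; linarith
    linarith
  · intro c hc
    obtain ⟨lam, h1, h2⟩ := exists_between (show -(1 / v) < c + 1 by linarith)
    have hlam : 0 < lam := hv'.trans h1
    have hs := step_zero hB hI hadd hb hk hkn hlam
    refine ⟨_, _, by linarith, hs.2, ?_⟩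
    have hlt : v < -(1 / lam) := by
      have h3 : 1 < lam * (-v) := by
        have := mul_lt_mul_of_pos_right h1 (neg_pos.2 hv)
        have e : -(1 / v) * -v = 1 := by field_simp [hv.ne]
        linarith
      have h4 : 1 / lam < -v := by rw [div_lt_iff₀ hlam]; linarith
      linarith
    filter_upwards [hmem lam hlam, arg_mem hB hk (v - 1), hs.1.eventually_const_lt hlt]
      with n a1 a2 a3
    refine mul_le_mul_of_nonneg_left (sub_le_sub_right ?_ _) (by positivity)
    refine (hA 1 _).monotoneOn (a2.2 v ⟨by linarith, hv⟩) a1 ?_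
    have h4 : v / (B * k n) < f ⌊lam * k n⌋₊ 0 - 1 := by
      rw [div_lt_iff₀ a2.1]; linarith
    linarith

theorem step_two (hB : 0 < B) (hI : ∀ n, f n 0 ∈ Set.Ico (0:ℝ) 1)
    (hadd : ∀ m l s, f (m + l) s = f m (f l s)) (hA : ∀ N m, AMon N (f m))
    (hb : Tendsto (fun n => 1 / (1 - f (n + 1) 0) - 1 / (1 - f n 0)) atTop (𝓝 B))
    (hk : Tendsto k atTop atTop) (hkn : Tendsto (fun n : ℕ => (k n : ℝ) / n) atTop (𝓝 0)) (j : ℕ) :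
    ∀ v ∈ Set.Ioo (-2:ℝ) 0,
    Tendsto (fun n : ℕ => B * (n:ℝ) ^ 2 / k n / (B * k n) ^ j *
        (iteratedDeriv j (f (n - k n)) (1 + v / (B * k n)) - if j = 0 then f n 0 else 0)) atTop
      (𝓝 ((Nat.factorial j : ℝ) / (-v) ^ (j + 1) - if j = 0 then 1 else 0)) := by
  induction j with
  | zero =>
    intro v hv
    have := step_one hB hI hadd hA hb hk hkn hv.2
    simpa [neg_div, div_neg] using this
  | succ j ih =>
    intro v hv
    refine tendsto_deriv_of_mono (H' := fun (n : ℕ) v => B * (n:ℝ) ^ 2 / k n / (B * k n) ^ (j + 1) *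
        (iteratedDeriv (j + 1) (f (n - k n)) (1 + v / (B * k n)) - if j + 1 = 0 then f n 0 else 0))
      hv ?_ ?_ ih ?_
    · filter_upwards [arg_mem hB hk (-2)] with n h1 t ht
      have h2 : AMon 1 (iteratedDeriv j (f (n - k n))) := AMon.iter j (hA _ _)
      have h3 := (h2.2.1 _ (h1.2 t ht)).hasDerivAt
      rw [← iteratedDeriv_succ] at h3
      have h4 : HasDerivAt (fun t : ℝ => 1 + t / (B * k n)) (1 / (B * k n)) t :=
        ((hasDerivAt_id t).div_const _).const_add 1
      have h5 := ((h3.comp t h4).sub_const (if j = 0 then f n 0 else 0)).const_mul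
        (B * (n:ℝ) ^ 2 / k n / (B * k n) ^ j)
      have e : B * (n:ℝ) ^ 2 / k n / (B * k n) ^ (j + 1) *
        (iteratedDeriv (j + 1) (f (n - k n)) (1 + t / (B * k n)) - if j + 1 = 0 then f n 0 else 0)
        = B * (n:ℝ) ^ 2 / k n / (B * k n) ^ j *
          (iteratedDeriv (j + 1) (f (n - k n)) (1 + t / (B * k n)) * (1 / (B * k n))) := by
        rw [if_neg (Nat.succ_ne_zero j), sub_zero, pow_succ (B * (k n : ℝ)), ← div_div _ _ (B * (k n : ℝ))]
        ring
      rw [e]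
      exact h5
    · filter_upwards [arg_mem hB hk (-2)] with n h1 t ht u hu htu
      have h2 : AMon 1 (iteratedDeriv (j + 1) (f (n - k n))) := AMon.iter (j + 1) (hA _ _)
      refine mul_le_mul_of_nonneg_left (sub_le_sub_right ?_ _) (by positivity)
      refine h2.monotoneOn (h1.2 t ht) (h1.2 u hu) ?_
      have := div_le_div_of_nonneg_right htu h1.1.le
      linarith
    · have hv0 : -v ≠ 0 := by have := hv.2; exact neg_ne_zero.2 this.ne
      have h1 : HasDerivAt (fun t : ℝ => (-t) ^ (j + 1)) (((j + 1 : ℕ) : ℝ) * (-v) ^ j * (-1)) v := by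
        exact ((hasDerivAt_id v).neg).pow (j + 1)
      have h2 := ((hasDerivAt_const v (Nat.factorial j : ℝ)).div h1 (pow_ne_zero _ hv0)).sub_const
        (if j = 0 then (1:ℝ) else 0)
      suffices e : ((j + 1).factorial : ℝ) / (-v) ^ (j + 1 + 1) - (if j + 1 = 0 then 1 else 0) =
          (0 * (-v) ^ (j + 1) - (j.factorial : ℝ) * (((j + 1 : ℕ) : ℝ) * (-v) ^ j * -1)) /
            ((-v) ^ (j + 1)) ^ 2 by
        rw [e]; exact h2
      rw [if_neg (Nat.succ_ne_zero j), Nat.factorial_succ]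
      push_cast
      rw [sub_zero, div_eq_div_iff (pow_ne_zero _ hv0) (pow_ne_zero _ (pow_ne_zero _ hv0))]
      ring

theorem step_three (hB : 0 < B) (hI : ∀ n, f n 0 ∈ Set.Ico (0:ℝ) 1)
    (hadd : ∀ m l s, f (m + l) s = f m (f l s)) (hA : ∀ N m, AMon N (f m))
    (hb : Tendsto (fun n => 1 / (1 - f (n + 1) 0) - 1 / (1 - f n 0)) atTop (𝓝 B))
    (hk : Tendsto k atTop atTop) (hkn : Tendsto (fun n : ℕ => (k n : ℝ) / n) atTop (𝓝 0)) (j : ℕ)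
    (hj : 1 ≤ j) :
    Tendsto (fun n : ℕ => B * (n:ℝ) ^ 2 / k n / (B * k n) ^ j *
        iteratedDeriv j (f (n - k n)) (f (k n) 0)) atTop (𝓝 (Nat.factorial j : ℝ)) := by
  have hw := (step_zero hB hI hadd hb hk hkn one_pos).1
  simp only [one_mul, Nat.floor_natCast, div_one] at hw
  have hj0 : j ≠ 0 := by omega
  have hlim := step_two hB hI hadd hA hb hk hkn j
  simp only [if_neg hj0, sub_zero] at hlim
  have h := tendsto_moving (α := -2) (β := 0) (v := -1)
    (H := fun (n : ℕ) v => B * (n:ℝ) ^ 2 / k n / (B * k n) ^ j *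
        (iteratedDeriv j (f (n - k n)) (1 + v / (B * k n))))
    (G := fun v => (Nat.factorial j : ℝ) / (-v) ^ (j + 1)) (by norm_num) ?_ ?_ hlim hw
  · simp only [neg_neg, one_pow, div_one] at h
    refine h.congr' ?_
    filter_upwards [arg_mem hB hk (-2)] with n h1
    have e : 1 + B * k n * (f (k n) 0 - 1) / (B * k n) = f (k n) 0 := by
      rw [mul_div_cancel_left₀ _ h1.1.ne']; ring
    rw [e]
  · filter_upwards [arg_mem hB hk (-2)] with n h1 t ht u hu htu
    have h2 : AMon 1 (iteratedDeriv j (f (n - k n))) := AMon.iter j (hA _ _)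
    refine mul_le_mul_of_nonneg_left ?_ (by positivity)
    refine h2.monotoneOn (h1.2 t ht) (h1.2 u hu) ?_
    have := div_le_div_of_nonneg_right htu h1.1.le
    linarith
  · refine ContinuousAt.div (by fun_prop) (by fun_prop) (by norm_num)

end main

theorem iterate_deriv_asymptotics_small    (p : ℕ → ℝ) (hp0 : ∀ k, 0 ≤ p k) (hp1 : ∑' k, p k = 1)
    (hmean : ∑' k : ℕ, (k : ℝ) * p k = 1) (B : ℝ) (hB : 0 < B)
    (hsq : Summable fun k : ℕ => (k : ℝ) ^ 2 * p k)
    (hvar : (∑' k : ℕ, (k : ℝ) ^ 2 * p k) - 1 = 2 * B)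
    (φ : ℕ → ℝ) (hφ : Tendsto φ atTop atTop)
    (hφo : (fun n : ℕ => φ n) =o[atTop] fun n : ℕ => (n : ℝ)) :
    ∀ x : ℝ, 0 < x → ∀ j : ℕ, 1 ≤ j →
      (fun n : ℕ => iteratedDeriv j (pgfIter p (n - ⌊x * φ n⌋₊))
          (pgfIter p ⌊x * φ n⌋₊ 0)) ~[atTop]
        fun n : ℕ => (Nat.factorial j : ℝ) * (B * x * φ n) ^ (j + 1) / (B ^ 2 * (n : ℝ) ^ 2) := by
  intro x hx j hj
  obtain ⟨hI, hA, hb⟩ := pgfIter_facts p hp0 hp1 hmean B hB hsq hvar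
  have hxφ : Tendsto (fun n => x * φ n) atTop atTop := hφ.const_mul_atTop hx
  have hk : Tendsto (fun n => ⌊x * φ n⌋₊) atTop atTop := tendsto_nat_floor_atTop.comp hxφ
  have hkr : Tendsto (fun n => (⌊x * φ n⌋₊ : ℝ) / (x * φ n)) atTop (𝓝 1) :=
    tendsto_nat_floor_div_atTop.comp hxφ
  have hkn : Tendsto (fun n => (⌊x * φ n⌋₊ : ℝ) / n) atTop (𝓝 0) := by
    have h1 := (hkr.mul (hφo.tendsto_div_nhds_zero.const_mul x))
    simp only [mul_zero] at h1
    refine h1.congr' ?_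
    filter_upwards [hxφ.eventually_gt_atTop 0] with n hn
    have := hn.ne'
    rw [← mul_div_assoc, ← mul_div_assoc, div_mul_cancel₀ _ this]
  have hmain := step_three hB hI (pgfIter_add p) hA hb hk hkn j hj
  have hfac : (Nat.factorial j : ℝ) ≠ 0 := by positivity
  refine isEquivalent_of_tendsto_one ?_
  have h2 := (hmain.div_const (Nat.factorial j : ℝ)).mul (hkr.pow (j + 1))
  rw [div_self hfac, one_pow, mul_one] at h2
  refine h2.congr' ?_
  filter_upwards [hxφ.eventually_gt_atTop 0, hk.eventually_gt_atTop 0, eventually_gt_atTop 0]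
    with n h3 h4 h5
  simp only [Pi.div_apply]
  have e1 : B * x * φ n = B * (x * φ n) := by ring
  rw [e1]
  have q1 : (n:ℝ) ≠ 0 := by positivity
  have q2 : (⌊x * φ n⌋₊ : ℝ) ≠ 0 := by positivity
  have q3 := h3.ne'
  generalize iteratedDeriv j (pgfIter p (n - ⌊x * φ n⌋₊)) (pgfIter p ⌊x * φ n⌋₊ 0) = D
  generalize (⌊x * φ n⌋₊ : ℝ) = K at *
  generalize x * φ n = y at *
  rw [mul_pow, mul_pow, div_pow, pow_succ B, pow_succ K]
  field_simp
end

section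
/- Under the conditions of Theorem 1 (critical aperiodic GW process, Var(ξ)=2B ∈ (0,∞), φ(n)→∞, φ(n)=o(n)), for any fixed j ≥ 1 and x > 0, P(Z(n - ⌊xφ(n)⌋, n) = j) ~ xφ(n)/(Bn²) as n → ∞. -/
open MeasureTheory Filter Topology Asymptotics Real

theorem coef_conv0 (a : ℕ → ℕ → ℝ) (F : ℕ → ℝ → ℝ)
    (ha : ∀ᶠ n in atTop, ∀ i, 0 ≤ a n i)
    (hF : ∀ s : ℝ, 0 < s → s < 1 → ∀ᶠ n in atTop, HasSum (fun i => a n i * s ^ i) (F n s))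
    (hl : ∀ s : ℝ, 0 < s → s < 1 → Tendsto (fun n => F n s) atTop (𝓝 (1 / (1 - s)))) :
    Tendsto (fun n => a n 0) atTop (𝓝 1) := by
  have up : ∀ s : ℝ, 0 < s → s < 1 → ∀ᶠ n in atTop, a n 0 ≤ F n s := by
    intro s h0 h1
    filter_upwards [ha, hF s h0 h1] with n hn hs
    have := le_hasSum hs 0 (fun j _ => mul_nonneg (hn j) (by positivity))
    simpa using this
  have low : ∀ s : ℝ, 0 < s → s < 1/2 → ∀ᶠ n in atTop, F n s - 2 * s * F n (1/2) ≤ a n 0 := by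
    intro s h0 h1
    filter_upwards [ha, hF s h0 (by linarith), hF (1/2) (by norm_num) (by norm_num)] with n hn hs ht
    have h2 := hs.sub (ht.mul_left (2 * s))
    have h3 : HasSum (fun i => if i = 0 then a n 0 else 0) (a n 0) := hasSum_ite_eq 0 (a n 0)
    refine hasSum_le ?_ h2 h3
    intro i
    rcases i with _ | i
    · have := hn 0
      simp
      nlinarith
    · have h4 : s ^ i ≤ (1/2:ℝ) ^ i := by gcongr
      have h5 := hn (i+1)
      simp only [Nat.add_eq_zero_iff, one_ne_zero, and_false, if_false, pow_succ]
      have : a n (i+1) * (s ^ i * s) ≤ a n (i+1) * ((1/2:ℝ)^i * s) := by gcongr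
      nlinarith
  rw [tendsto_order]
  constructor
  · intro b hb
    have hc : Tendsto (fun s : ℝ => 1 / (1 - s) - 2 * s * (1 / (1 - 1/2))) (𝓝[>] 0) (𝓝 1) := by
      have : ContinuousAt (fun s : ℝ => 1 / (1 - s) - 2 * s * (1 / (1 - 1/2))) 0 := by
        apply ContinuousAt.sub
        · exact ContinuousAt.div (by fun_prop) (by fun_prop) (by norm_num)
        · fun_prop
      have h := this.tendsto.mono_left (nhdsWithin_le_nhds (s := Set.Ioi 0))
      simpa using h
    have e1 := hc.eventually (lt_mem_nhds hb)
    have e2 : ∀ᶠ s : ℝ in 𝓝[>] 0, s ∈ Set.Ioo (0:ℝ) (1/2) := Ioo_mem_nhdsGT (by norm_num)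
    obtain ⟨s, hs1, hs2, hs3⟩ := (e1.and e2).exists
    have := ((hl s hs2 (by linarith)).sub ((hl (1/2) (by norm_num) (by norm_num)).const_mul (2*s)))
    filter_upwards [this.eventually (lt_mem_nhds hs1), low s hs2 hs3] with n h1 h2
    linarith
  · intro b hb
    have hc : Tendsto (fun s : ℝ => 1 / (1 - s)) (𝓝[>] 0) (𝓝 1) := by
      have : ContinuousAt (fun s : ℝ => 1 / (1 - s)) 0 :=
        ContinuousAt.div (by fun_prop) (by fun_prop) (by norm_num)
      have h := this.tendsto.mono_left (nhdsWithin_le_nhds (s := Set.Ioi 0))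
      simpa using h
    have e1 := hc.eventually (gt_mem_nhds hb)
    have e2 : ∀ᶠ s : ℝ in 𝓝[>] 0, s ∈ Set.Ioo (0:ℝ) (1/2) := Ioo_mem_nhdsGT (by norm_num)
    obtain ⟨s, hs1, hs2, hs3⟩ := (e1.and e2).exists
    filter_upwards [(hl s hs2 (by linarith)).eventually (gt_mem_nhds hs1), up s hs2 (by linarith)] with n h1 h2
    linarith

theorem coef_conv (i : ℕ) : ∀ (a : ℕ → ℕ → ℝ) (F : ℕ → ℝ → ℝ)
    (_ : ∀ᶠ n in atTop, ∀ i, 0 ≤ a n i)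
    (_ : ∀ s : ℝ, 0 < s → s < 1 → ∀ᶠ n in atTop, HasSum (fun i => a n i * s ^ i) (F n s))
    (_ : ∀ s : ℝ, 0 < s → s < 1 → Tendsto (fun n => F n s) atTop (𝓝 (1 / (1 - s)))),
    Tendsto (fun n => a n i) atTop (𝓝 1) := by
  induction i with
  | zero => exact fun a F ha hF hl => coef_conv0 a F ha hF hl
  | succ i ih =>
    intro a F ha hF hl
    refine ih (fun n i => a n (i+1)) (fun n s => (F n s - a n 0) / s) ?_ ?_ ?_
    · filter_upwards [ha] with n hn i using hn _
    · intro s h0 h1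
      filter_upwards [hF s h0 h1] with n hn
      have h := ((hasSum_nat_add_iff' 1).mpr hn).div_const s
      simp only [Finset.sum_range_one, pow_zero, mul_one] at h
      have hfun : (fun i => a n (i+1) * s ^ i) = fun i => a n (i+1) * s ^ (i+1) / s := by
        funext i
        rw [pow_succ]; field_simp
      rw [hfun]; exact h
    · intro s h0 h1
      have h := ((hl s h0 h1).sub (coef_conv0 a F ha hF hl)).div_const s
      convert h using 2
      have : (1 - s) ≠ 0 := by linarith
      field_simp
      ring

/-- second-order quotient polynomials -/
noncomputable def eaux : ℕ → ℝ → ℝ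
  | 0 => fun _ => 0
  | k + 1 => fun s => s * eaux k s + k

theorem eaux_id (k : ℕ) (s : ℝ) : s ^ k = 1 - k * (1 - s) + (1 - s) ^ 2 * eaux k s := by
  induction k with
  | zero => simp [eaux]
  | succ k ih => rw [pow_succ, ih]; simp only [eaux]; push_cast; ring

theorem eaux_cont (k : ℕ) : Continuous (eaux k) := by
  induction k with
  | zero => exact continuous_const
  | succ k ih => simp only [eaux]; fun_prop

theorem eaux_one (k : ℕ) : eaux k 1 = ((k:ℝ) ^ 2 - k) / 2 := by
  induction k with
  | zero => simp [eaux]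
  | succ k ih => simp only [eaux, ih]; push_cast; ring

theorem eaux_nonneg (k : ℕ) (s : ℝ) (h0 : 0 ≤ s) : 0 ≤ eaux k s := by
  induction k with
  | zero => simp [eaux]
  | succ k ih => simp only [eaux]; positivity

theorem eaux_le (k : ℕ) (s : ℝ) (h0 : 0 ≤ s) (h1 : s ≤ 1) : eaux k s ≤ (k:ℝ)^2 := by
  induction k with
  | zero => simp [eaux]
  | succ k ih =>
    simp only [eaux]; push_cast
    have := eaux_nonneg k s h0
    nlinarith

theorem eaux_ge (k : ℕ) (hk : 2 ≤ k) (s : ℝ) (h0 : 0 ≤ s) : 1 ≤ eaux k s := by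
  obtain ⟨k, rfl⟩ : ∃ j, k = j + 2 := ⟨k - 2, by omega⟩
  have := eaux_nonneg (k+1) s h0
  simp only [eaux] at *; push_cast
  have : 0 ≤ s * (s * eaux k s + k) := by positivity
  have : (0:ℝ) ≤ k := by positivity
  linarith

noncomputable def haux (p : ℕ → ℝ) (s : ℝ) : ℝ := ∑' k, p k * eaux k s

section
variable (p : ℕ → ℝ) (hp0 : ∀ k, 0 ≤ p k) (hp1 : ∑' k, p k = 1)
    (hmean : ∑' k : ℕ, (k : ℝ) * p k = 1) (B : ℝ) (hB : 0 < B)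
    (hsq : Summable fun k : ℕ => (k : ℝ) ^ 2 * p k)
    (hvar : (∑' k : ℕ, (k : ℝ) ^ 2 * p k) - 1 = 2 * B)

theorem summ_of_tsum {g : ℕ → ℝ} (h : ∑' k, g k = 1) : Summable g := by
  by_contra hc
  rw [tsum_eq_zero_of_not_summable hc] at h
  norm_num at h

theorem summ_e (hp0 : ∀ k, 0 ≤ p k) (hsq : Summable fun k : ℕ => (k : ℝ) ^ 2 * p k)
    (s : ℝ) (h0 : 0 ≤ s) (h1 : s ≤ 1) : Summable fun k => p k * eaux k s := by
  refine Summable.of_nonneg_of_le (fun k => mul_nonneg (hp0 k) (eaux_nonneg k s h0)) ?_ hsq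
  intro k
  rw [mul_comm]
  exact mul_le_mul_of_nonneg_right (eaux_le k s h0 h1) (hp0 k)

theorem pgf_eq (hp0 : ∀ k, 0 ≤ p k) (hp1 : ∑' k, p k = 1)
    (hmean : ∑' k : ℕ, (k : ℝ) * p k = 1)
    (hsq : Summable fun k : ℕ => (k : ℝ) ^ 2 * p k)
    (s : ℝ) (h0 : 0 ≤ s) (h1 : s ≤ 1) : pgf p s = s + (1 - s) ^ 2 * haux p s := by
  have a1 : HasSum p 1 := hp1 ▸ (summ_of_tsum hp1).hasSum
  have a2 : HasSum (fun k : ℕ => (k:ℝ) * p k) 1 := by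
    have := (summ_of_tsum hmean).hasSum
    rwa [hmean] at this
  have a3 := (summ_e p hp0 hsq s h0 h1).hasSum
  have := (a1.sub (a2.mul_right (1 - s))).add (a3.mul_left ((1-s)^2))
  have e : HasSum (fun k => p k * s ^ k) (1 - 1 * (1 - s) + (1-s)^2 * haux p s) := by
    have hfun : (fun k => p k * s ^ k) =
        fun k => p k - (k:ℝ) * p k * (1 - s) + (1-s)^2 * (p k * eaux k s) := by
      funext k
      rw [eaux_id k s]; ring
    rw [hfun]; exact this
  rw [pgf, e.tsum_eq]; ring

theorem haux_cont (hp0 : ∀ k, 0 ≤ p k) (hsq : Summable fun k : ℕ => (k : ℝ) ^ 2 * p k) :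
    ContinuousOn (haux p) (Set.Icc 0 1) := by
  refine continuousOn_tsum (fun k => ((eaux_cont k).const_mul (p k)).continuousOn) hsq ?_
  intro k s hs
  rw [Real.norm_of_nonneg (mul_nonneg (hp0 k) (eaux_nonneg k s hs.1)), mul_comm]
  exact mul_le_mul_of_nonneg_right (eaux_le k s hs.1 hs.2) (hp0 k)

theorem haux_one (hmean : ∑' k : ℕ, (k : ℝ) * p k = 1) (B : ℝ)
    (hsq : Summable fun k : ℕ => (k : ℝ) ^ 2 * p k)
    (hvar : (∑' k : ℕ, (k : ℝ) ^ 2 * p k) - 1 = 2 * B) : haux p 1 = B := by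
  have a2 : HasSum (fun k : ℕ => (k:ℝ) * p k) 1 := by
    have := (summ_of_tsum hmean).hasSum
    rwa [hmean] at this
  have := (hsq.hasSum.sub a2).div_const 2
  have e : HasSum (fun k => p k * eaux k 1) (((∑' k : ℕ, (k : ℝ) ^ 2 * p k) - 1)/2) := by
    have hfun : (fun k => p k * eaux k 1) = fun k : ℕ => ((k:ℝ)^2 * p k - k * p k) / 2 := by
      funext k
      rw [eaux_one]; ring
    rw [hfun]; exact this
  rw [haux, e.tsum_eq]; linarith

theorem exists_k (hp0 : ∀ k, 0 ≤ p k) (hmean : ∑' k : ℕ, (k : ℝ) * p k = 1) (B : ℝ) (hB : 0 < B)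
    (hvar : (∑' k : ℕ, (k : ℝ) ^ 2 * p k) - 1 = 2 * B) : ∃ k, 2 ≤ k ∧ 0 < p k := by
  by_contra! hc
  have : ∀ k : ℕ, (k:ℝ)^2 * p k = k * p k := by
    intro k
    rcases Nat.lt_or_ge k 2 with h | h
    · interval_cases k <;> simp
    · rw [le_antisymm (hc k h) (hp0 k)]; simp
  simp_rw [this, hmean] at hvar
  linarith

theorem haux_ge (hp0 : ∀ k, 0 ≤ p k) (hsq : Summable fun k : ℕ => (k : ℝ) ^ 2 * p k)
    (k : ℕ) (hk : 2 ≤ k) (s : ℝ) (h0 : 0 ≤ s) (h1 : s ≤ 1) : p k ≤ haux p s := by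
  have := (summ_e p hp0 hsq s h0 h1).le_tsum k
    (fun j _ => mul_nonneg (hp0 j) (eaux_nonneg j s h0))
  have h2 := mul_le_mul_of_nonneg_left (eaux_ge k hk s h0) (hp0 k)
  unfold haux
  linarith

theorem summ_pow (hp0 : ∀ k, 0 ≤ p k) (hp1 : ∑' k, p k = 1) (s : ℝ) (h0 : 0 ≤ s) (h1 : s ≤ 1) :
    Summable fun k => p k * s ^ k :=
  Summable.of_nonneg_of_le (fun k => mul_nonneg (hp0 k) (by positivity))
    (fun k => mul_le_of_le_one_right (hp0 k) (pow_le_one₀ h0 h1)) (summ_of_tsum hp1)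

theorem pgf_mono (hp0 : ∀ k, 0 ≤ p k) (hp1 : ∑' k, p k = 1) (s t : ℝ) (h0 : 0 ≤ s) (hst : s ≤ t)
    (h1 : t ≤ 1) : pgf p s ≤ pgf p t := by
  refine (summ_pow p hp0 hp1 s h0 (hst.trans h1)).tsum_le_tsum ?_ (summ_pow p hp0 hp1 t (h0.trans hst) h1)
  intro k
  have := hp0 k
  gcongr

theorem pgf_one (hp1 : ∑' k, p k = 1) : pgf p 1 = 1 := by simp [pgf, hp1]

theorem pgf_nonneg (hp0 : ∀ k, 0 ≤ p k) (s : ℝ) (h0 : 0 ≤ s) : 0 ≤ pgf p s :=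
  tsum_nonneg fun k => mul_nonneg (hp0 k) (by positivity)

theorem pgf_lt (hp0 : ∀ k, 0 ≤ p k) (hp1 : ∑' k, p k = 1) (k : ℕ) (hk : 2 ≤ k) (hpk : 0 < p k)
    (s : ℝ) (h0 : 0 ≤ s) (h1 : s < 1) : pgf p s < 1 := by
  rw [← hp1]
  refine (summ_pow p hp0 hp1 s h0 h1.le).tsum_lt_tsum (i := k)
    (fun k => mul_le_of_le_one_right (hp0 k) (pow_le_one₀ h0 h1.le)) ?_ (summ_of_tsum hp1)
  have := pow_lt_one₀ h0 h1 (by omega : k ≠ 0)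
  nlinarith

theorem iter_mem (hp0 : ∀ k, 0 ≤ p k) (hp1 : ∑' k, p k = 1) (n : ℕ) (s : ℝ)
    (hs : s ∈ Set.Icc (0:ℝ) 1) : pgfIter p n s ∈ Set.Icc (0:ℝ) 1 := by
  induction n with
  | zero => exact hs
  | succ n ih =>
    refine ⟨pgf_nonneg p hp0 _ ih.1, ?_⟩
    rw [← pgf_one p hp1]
    exact pgf_mono p hp0 hp1 _ _ ih.1 ih.2 le_rfl

theorem iter_mono (hp0 : ∀ k, 0 ≤ p k) (hp1 : ∑' k, p k = 1) (n : ℕ) (s t : ℝ)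
    (h0 : 0 ≤ s) (hst : s ≤ t) (h1 : t ≤ 1) : pgfIter p n s ≤ pgfIter p n t := by
  induction n with
  | zero => exact hst
  | succ n ih =>
    exact pgf_mono p hp0 hp1 _ _ (iter_mem p hp0 hp1 n s ⟨h0, hst.trans h1⟩).1 ih
      (iter_mem p hp0 hp1 n t ⟨h0.trans hst, h1⟩).2

theorem iter_one (hp1 : ∑' k, p k = 1) (n : ℕ) : pgfIter p n 1 = 1 := by
  induction n with
  | zero => rfl
  | succ n ih => simp only [pgfIter, ih, pgf_one p hp1]

theorem iter_add (m n : ℕ) (s : ℝ) : pgfIter p (m + n) s = pgfIter p m (pgfIter p n s) := by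
  induction m with
  | zero => simp [pgfIter]
  | succ m ih => rw [Nat.succ_add]; simp only [pgfIter, ih]

/-- survival probability -/
noncomputable def Qs (p : ℕ → ℝ) (n : ℕ) : ℝ := 1 - pgfIter p n 0

theorem Q_facts (hp0 : ∀ k, 0 ≤ p k) (hp1 : ∑' k, p k = 1)
    (hmean : ∑' k : ℕ, (k : ℝ) * p k = 1) (B : ℝ) (hB : 0 < B)
    (hsq : Summable fun k : ℕ => (k : ℝ) ^ 2 * p k)
    (hvar : (∑' k : ℕ, (k : ℝ) ^ 2 * p k) - 1 = 2 * B) :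
    (∀ n, 0 < Qs p n) ∧ (∀ n, Qs p n ≤ 1) ∧ StrictAnti (Qs p) ∧ Tendsto (Qs p) atTop (𝓝 0) ∧
    Tendsto (fun n => (Qs p (n+1))⁻¹ - (Qs p n)⁻¹) atTop (𝓝 B) := by
  obtain ⟨k, hk, hpk⟩ := exists_k p hp0 hmean B hB hvar
  have mem : ∀ n, pgfIter p n 0 ∈ Set.Icc (0:ℝ) 1 := fun n => iter_mem p hp0 hp1 n 0 (by simp)
  have pos : ∀ n, 0 < Qs p n := by
    intro n
    induction n with
    | zero => simp [Qs, pgfIter]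
    | succ n ih =>
      have := pgf_lt p hp0 hp1 k hk hpk (pgfIter p n 0) (mem n).1 (by unfold Qs at ih; linarith)
      unfold Qs; simp only [pgfIter]; linarith
  have le1 : ∀ n, Qs p n ≤ 1 := fun n => by have := (mem n).1; unfold Qs; linarith
  have rec' : ∀ n, Qs p (n+1) = Qs p n - (Qs p n)^2 * haux p (1 - Qs p n) := by
    intro n
    have := pgf_eq p hp0 hp1 hmean hsq (pgfIter p n 0) (mem n).1 (mem n).2
    unfold Qs; simp only [pgfIter]; rw [this]; simp only [sub_sub_cancel]; ring
  have hge : ∀ n, p k ≤ haux p (1 - Qs p n) := fun n =>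
    haux_ge p hp0 hsq k hk _ (by linarith [le1 n]) (by linarith [pos n])
  have anti : StrictAnti (Qs p) := by
    refine strictAnti_nat_of_succ_lt fun n => ?_
    rw [rec']
    have := hge n
    have : 0 < (Qs p n)^2 * haux p (1 - Qs p n) := mul_pos (pow_pos (pos n) 2) (by linarith)
    linarith
  have lim : Tendsto (Qs p) atTop (𝓝 0) := by
    have hb : BddBelow (Set.range (Qs p)) := ⟨0, by rintro _ ⟨n, rfl⟩; exact (pos n).le⟩
    have hL := tendsto_atTop_ciInf anti.antitone hb
    set L := ⨅ i, Qs p i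
    have hL0 : 0 ≤ L := ge_of_tendsto' hL (fun n => (pos n).le)
    have hL1 := hL.comp (tendsto_add_atTop_nat 1)
    have h2 : L ≤ L - L^2 * p k := by
      refine le_of_tendsto_of_tendsto' hL1 (hL.sub ((hL.pow 2).mul_const (p k))) ?_
      intro n
      simp only [Function.comp]
      rw [rec']
      have := mul_le_mul_of_nonneg_left (hge n) (sq_nonneg (Qs p n))
      linarith
    have : L = 0 := by
      by_contra hne
      have : 0 < L^2 * p k := by positivity
      linarith
    rwa [this] at hL
  refine ⟨pos, le1, anti, lim, ?_⟩
  have hh : Tendsto (fun n => haux p (1 - Qs p n)) atTop (𝓝 B) := by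
    rw [← haux_one p hmean B hsq hvar]
    have hc := haux_cont p hp0 hsq 1 (by simp)
    refine hc.tendsto.comp (tendsto_nhdsWithin_iff.mpr ⟨?_, ?_⟩)
    · simpa using lim.const_sub 1
    · exact Eventually.of_forall fun n => ⟨by linarith [le1 n], by linarith [pos n]⟩
  have := hh.div ((lim.mul hh).const_sub 1) (by simp)
  simp only [zero_mul, sub_zero, div_one] at this
  refine this.congr fun n => ?_
  have h1 := pos n
  have h2 := pos (n+1)
  rw [rec'] at h2 ⊢
  have h3 : Qs p n - (Qs p n)^2 * haux p (1 - Qs p n) = Qs p n * (1 - Qs p n * haux p (1 - Qs p n)) := by ring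
  rw [h3] at h2 ⊢
  have h4 := (mul_pos_iff_of_pos_left h1).mp h2
  simp only [Pi.div_apply]
  field_simp
  ring

end

theorem r_div (r : ℕ → ℝ) (B : ℝ) (hr : Tendsto (fun n => r (n+1) - r n) atTop (𝓝 B)) :
    Tendsto (fun n : ℕ => r n / n) atTop (𝓝 B) := by
  have := hr.cesaro
  simp_rw [Finset.sum_range_sub] at this
  have h2 : Tendsto (fun n : ℕ => r 0 / (n:ℝ)) atTop (𝓝 0) :=
    tendsto_const_nhds.div_atTop tendsto_natCast_atTop_atTop
  have h3 := this.add h2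
  rw [add_zero] at h3
  refine h3.congr fun n => ?_
  ring

theorem r_incr (r : ℕ → ℝ) (B : ℝ) (hr : Tendsto (fun n => r (n+1) - r n) atTop (𝓝 B))
    (d : ℕ → ℕ) : (fun n => r (n + d n) - r n - B * d n) =o[atTop] fun n => (d n : ℝ) := by
  rw [isLittleO_iff]
  intro ε hε
  obtain ⟨N, hN⟩ := (Metric.tendsto_atTop.mp hr) ε hε
  filter_upwards [eventually_ge_atTop N] with n hn
  generalize d n = e
  have : |r (n + e) - r n - B * e| ≤ ε * e := by
    induction e with
    | zero => simp
    | succ e ih =>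
      have h1 := hN (n + e) (by omega)
      rw [Real.dist_eq] at h1
      rw [← add_assoc]; push_cast
      rw [abs_le] at *
      rw [abs_lt] at h1
      constructor <;> linarith
  simpa using this

/-- Index at which the reciprocal survival probability passes the level `r k / (1 - s)`. -/
theorem exists_L (r : ℕ → ℝ) (B : ℝ) (hB : 0 < B) (hr1 : ∀ n, 0 < r n) (hm : StrictMono r)
    (hr : Tendsto (fun n => r (n+1) - r n) atTop (𝓝 B)) (s : ℝ) (h0 : 0 < s) (h1 : s < 1) :
    ∃ D : ℕ → ℕ, (∀ k, r (k + D k) ≤ r k / (1 - s) ∧ r k / (1 - s) < r (k + D k + 1)) ∧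
      Tendsto (fun k => (D k : ℝ) / k) atTop (𝓝 (s / (1 - s))) := by
  have hrd := r_div r B hr
  have hs : 0 < 1 - s := by linarith
  have hrinf : Tendsto r atTop atTop := by
    have := hrd.pos_mul_atTop hB tendsto_natCast_atTop_atTop
    refine this.congr' ?_
    filter_upwards [eventually_gt_atTop 0] with n hn
    field_simp
  have ex : ∀ k, ∃ D, r (k + D) ≤ r k / (1 - s) ∧ r k / (1 - s) < r (k + D + 1) := by
    intro k
    have hex : ∃ D, r k / (1 - s) < r (k + D + 1) := by
      obtain ⟨N, hN⟩ := (hrinf.eventually_gt_atTop (r k / (1 - s))).exists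
      exact ⟨N, hN.trans (hm (by omega))⟩
    classical
    refine ⟨Nat.find hex, ?_, Nat.find_spec hex⟩
    rcases hD : Nat.find hex with _ | e
    · rw [add_zero, le_div_iff₀ hs]; nlinarith [hr1 k]
    · have := Nat.find_min hex (m := e) (by omega)
      rw [← add_assoc]; linarith
  choose D hD using ex
  refine ⟨D, hD, ?_⟩
  have hl : Tendsto (fun k => k + D k) atTop atTop := tendsto_atTop_mono (fun k => Nat.le_add_right _ _) tendsto_id
  have b1 : Tendsto (fun k => r (k + D k) / r k) atTop (𝓝 (1 / (1 - s))) := by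
    have hinc := hr.comp hl
    have low : Tendsto (fun k => 1 / (1 - s) - (r (k + D k + 1) - r (k + D k)) / r k) atTop (𝓝 (1/(1-s) - 0)) :=
      tendsto_const_nhds.sub (hinc.div_atTop hrinf)
    rw [sub_zero] at low
    refine tendsto_of_tendsto_of_tendsto_of_le_of_le low tendsto_const_nhds ?_ ?_
    · intro k
      have := (hD k).2
      have hk := hr1 k
      show 1 / (1 - s) - (r (k + D k + 1) - r (k + D k)) / r k ≤ r (k + D k) / r k
      rw [le_div_iff₀ hk, sub_mul, div_mul_cancel₀ _ hk.ne', one_div_mul_eq_div]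
      linarith
    · intro k
      have := (hD k).1
      show r (k + D k) / r k ≤ 1 / (1 - s)
      rw [div_le_iff₀ (hr1 k), one_div_mul_eq_div]; exact this
  have b2 := (b1.mul hrd).div (hrd.comp hl) hB.ne'
  have b3 := b2.sub_const 1
  have e : 1 / (1 - s) * B / B - 1 = s / (1 - s) := by field_simp; ring
  rw [e] at b3
  refine b3.congr' ?_
  filter_upwards [eventually_gt_atTop 0] with k hk
  have := hr1 k
  have := hr1 (k + D k)
  simp only [Pi.div_apply, Function.comp]
  have hk' : (0:ℝ) < k := by exact_mod_cast hk
  push_cast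
  field_simp
  ring

theorem diff_lim (Q : ℕ → ℝ) (B : ℝ) (hB : 0 < B) (hQ : ∀ n, 0 < Q n)
    (hr : Tendsto (fun n => (Q (n+1))⁻¹ - (Q n)⁻¹) atTop (𝓝 B))
    (ψ : ℕ → ℝ) (hψ : Tendsto ψ atTop atTop) (hψo : ψ =o[atTop] fun n : ℕ => (n : ℝ))
    (d : ℕ → ℕ) (θ : ℝ) (hd : Tendsto (fun n => (d n : ℝ) / ψ n) atTop (𝓝 θ)) :
    Tendsto (fun n : ℕ => B * (n:ℝ)^2 / ψ n * (Q n - Q (n + d n))) atTop (𝓝 θ) := by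
  have hrd := r_div (fun n => (Q n)⁻¹) B hr
  have hψ0 := hψ.eventually_gt_atTop 0
  have hn0 := eventually_gt_atTop (0:ℕ)
  have hdO : (fun n => (d n : ℝ)) =O[atTop] ψ :=
    isBigO_of_div_tendsto_nhds (by filter_upwards [hψ0] with n hn h; exact absurd h hn.ne') θ hd
  have hinc := (r_incr (fun n => (Q n)⁻¹) B hr d).trans_isBigO hdO
  have c1 := hinc.tendsto_div_nhds_zero.add (hd.const_mul B)
  have c2 : Tendsto (fun n : ℕ => (d n : ℝ) / n) atTop (𝓝 0) :=
    (hdO.trans_isLittleO hψo).tendsto_div_nhds_zero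
  have hl : Tendsto (fun n => n + d n) atTop atTop :=
    tendsto_atTop_mono (fun k => Nat.le_add_right _ _) tendsto_id
  have c3 := hrd.inv₀ hB.ne'
  have c4 := (hrd.comp hl).mul (c2.const_add 1)
  have c5 := c4.inv₀ (by simpa using hB.ne')
  have c6 := ((c1.const_mul B).mul c3).mul c5
  have e : B * (0 + B * θ) * B⁻¹ * (B * (1 + 0))⁻¹ = θ := by field_simp; ring
  rw [e] at c6
  refine c6.congr' ?_
  filter_upwards [hψ0, hn0] with n h1 h2
  have := hQ n
  have := hQ (n + d n)
  have hk' : (0:ℝ) < n := by exact_mod_cast h2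
  simp only [Function.comp]
  push_cast
  field_simp
  ring

theorem hasSum_prob {Ω : Type*} [MeasurableSpace Ω] (μ : Measure Ω) [IsProbabilityMeasure μ]
    (X : Ω → ℕ) (hX : Measurable X) (s : ℝ) (h0 : 0 ≤ s) (h1 : s ≤ 1) :
    HasSum (fun j : ℕ => (μ {ω | X ω = j}).toReal * s ^ j) (∫ ω, s ^ X ω ∂μ) := by
  have : IsProbabilityMeasure (μ.map X) := Measure.isProbabilityMeasure_map hX.aemeasurable
  have hint : Integrable (fun j : ℕ => s ^ j) (μ.map X) := by
    refine Integrable.of_bound (C := 1) (measurable_of_countable _).aestronglyMeasurable ?_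
    refine Eventually.of_forall fun j => ?_
    rw [Real.norm_of_nonneg (by positivity)]
    exact pow_le_one₀ h0 h1
  have e1 : ∫ ω, s ^ X ω ∂μ = ∫ j, s ^ j ∂(μ.map X) :=
    (integral_map hX.aemeasurable (f := fun j : ℕ => s ^ j)
      (measurable_of_countable _).aestronglyMeasurable).symm
  have e2 : ∀ j : ℕ, (μ {ω | X ω = j}).toReal = (μ.map X).real {j} := by
    intro j
    rw [Measure.real, Measure.map_apply hX (measurableSet_singleton j)]
    rfl
  rw [e1, integral_countable hint]
  simp_rw [e2, smul_eq_mul]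
  refine Summable.hasSum ?_
  have hs : Summable fun j : ℕ => (μ.map X).real {j} := by
    exact summable_measure_toReal (fun j => measurableSet_singleton j) (fun i j hij => by simpa [Function.onFun] using hij)
  exact Summable.of_nonneg_of_le (fun j => by positivity)
    (fun j => mul_le_of_le_one_right measureReal_nonneg (pow_le_one₀ h0 h1)) hs

theorem reduced_process_asymptotics    (p : ℕ → ℝ) (hp0 : ∀ k, 0 ≤ p k) (hp1 : ∑' k, p k = 1)
    (hmean : ∑' k : ℕ, (k : ℝ) * p k = 1) (B : ℝ) (hB : 0 < B)
    (hsq : Summable fun k : ℕ => (k : ℝ) ^ 2 * p k)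
    (hvar : (∑' k : ℕ, (k : ℝ) ^ 2 * p k) - 1 = 2 * B)
    (hgcd : ∀ d : ℕ, (∀ k, 0 < p k → d ∣ k) → d = 1)
    {Ω : Type*} [MeasurableSpace Ω] (μ : Measure Ω) [IsProbabilityMeasure μ]
    (Z : ℕ → Ω → ℕ) (hZm : ∀ n, Measurable (Z n))
    (hZ : ∀ n, ∀ s ∈ Set.Icc (0 : ℝ) 1, ∫ ω, s ^ Z n ω ∂μ = pgfIter p n s)
    (Zred : ℕ → ℕ → Ω → ℕ) (hZredm : ∀ m n, Measurable (Zred m n))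
    (hjoint : ∀ m n, m ≤ n → ∀ s ∈ Set.Icc (0 : ℝ) 1, ∀ u ∈ Set.Icc (0 : ℝ) 1,
      ∫ ω, s ^ Zred m n ω * u ^ Z n ω ∂μ =
        pgfIter p m (pgfIter p (n - m) 0 +
          s * (pgfIter p (n - m) u - pgfIter p (n - m) 0)))
    (φ : ℕ → ℝ) (hφ : Tendsto φ atTop atTop)
    (hφo : (fun n : ℕ => φ n) =o[atTop] fun n : ℕ => (n : ℝ)) :
    ∀ x : ℝ, 0 < x → ∀ j : ℕ, 1 ≤ j →
      (fun n : ℕ => (μ {ω | Zred (n - ⌊x * φ n⌋₊) n ω = j}).toReal) ~[atTop]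
        fun n : ℕ => x * φ n / (B * (n : ℝ) ^ 2) := by
  intro x hx j hj
  obtain ⟨Qpos, Qle, Qanti, -, Qinc⟩ := Q_facts p hp0 hp1 hmean B hB hsq hvar
  set ψ : ℕ → ℝ := fun n => x * φ n with hψdef
  have hψ : Tendsto ψ atTop atTop := hφ.const_mul_atTop hx
  have hψo : ψ =o[atTop] fun n : ℕ => (n : ℝ) := hφo.const_mul_left x
  have hψ0 := hψ.eventually_gt_atTop 0
  have hn0 := eventually_gt_atTop (0:ℕ)
  set k : ℕ → ℕ := fun n => ⌊ψ n⌋₊ with hk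
  have hkinf : Tendsto k atTop atTop := tendsto_nat_floor_atTop.comp hψ
  have hkψ : Tendsto (fun n => (k n : ℝ) / ψ n) atTop (𝓝 1) := (tendsto_nat_floor_div_atTop).comp hψ
  have hkn : ∀ᶠ n in atTop, k n ≤ n := by
    have := hψo.bound (c := 1) one_pos
    filter_upwards [this] with n hn
    simp only [Real.norm_eq_abs, Nat.abs_cast, one_mul] at hn
    exact Nat.floor_le_of_le ((le_abs_self _).trans hn)
  have hprob : ∀ n, k n ≤ n → ∀ s, 0 ≤ s → s ≤ 1 →
      HasSum (fun j : ℕ => (μ {ω | Zred (n - k n) n ω = j}).toReal * s ^ j)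
        (pgfIter p (n - k n) (1 - (1 - s) * Qs p (k n))) := by
    intro n hn s h0 h1
    have h := hasSum_prob μ (Zred (n - k n) n) (hZredm _ _) s h0 h1
    have h2 := hjoint (n - k n) n (Nat.sub_le _ _) s ⟨h0, h1⟩ 1 (by simp)
    simp only [one_pow, mul_one, iter_one p hp1, Nat.sub_sub_self hn] at h2
    rw [h2] at h
    convert h using 2
    unfold Qs; ring
  have key := coef_conv (j - 1)
    (fun n i => B * (n:ℝ)^2 / ψ n * (μ {ω | Zred (n - k n) n ω = i + 1}).toReal)
    (fun n s => B * (n:ℝ)^2 / ψ n *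
      (pgfIter p (n - k n) (1 - (1 - s) * Qs p (k n)) - (1 - Qs p n)) / s) ?_ ?_ ?_
  · rw [Nat.sub_add_cancel hj] at key
    refine (isEquivalent_iff_tendsto_one ?_).mpr ?_
    · filter_upwards [hψ0, hn0] with n h1 h2
      have hk' : (0:ℝ) < n := by exact_mod_cast h2
      exact (div_pos h1 (by positivity)).ne'
    · refine key.congr' ?_
      filter_upwards [hψ0, hn0] with n h1 h2
      have hk' : (0:ℝ) < n := by exact_mod_cast h2
      show B * (n:ℝ)^2 / ψ n * (μ {ω | Zred (n - k n) n ω = j}).toReal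
        = (μ {ω | Zred (n - k n) n ω = j}).toReal / (ψ n / (B * (n:ℝ)^2))
      field_simp
  · filter_upwards [hψ0] with n h1 i
    positivity
  · intro s h0 h1
    filter_upwards [hkn, hψ0] with n hn hψn
    have e0 : (μ {ω | Zred (n - k n) n ω = 0}).toReal = 1 - Qs p n := by
      have h := hprob n hn 0 le_rfl zero_le_one
      have h3 : HasSum (fun j : ℕ => (μ {ω | Zred (n - k n) n ω = j}).toReal * 0 ^ j)
          ((μ {ω | Zred (n - k n) n ω = 0}).toReal * 0 ^ 0) :=
        hasSum_single 0 (fun b hb => by simp [hb])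
      have := h3.unique h
      rw [pow_zero, mul_one] at this
      rw [this]
      simp only [Qs, sub_zero, one_mul, sub_sub_cancel]
      rw [← iter_add, Nat.sub_add_cancel hn]
    have h := (((hasSum_nat_add_iff' 1).mpr (hprob n hn s h0.le h1.le)).mul_left
      (B * (n:ℝ)^2 / ψ n)).div_const s
    simp only [Finset.sum_range_one, pow_zero, mul_one, e0] at h
    have hfun : (fun i : ℕ => B * (n:ℝ)^2 / ψ n * (μ {ω | Zred (n - k n) n ω = i + 1}).toReal * s ^ i)
        = fun i : ℕ => B * (n:ℝ)^2 / ψ n * ((μ {ω | Zred (n - k n) n ω = i + 1}).toReal * s ^ (i+1)) / s := by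
      funext i
      field_simp
      ring
    rw [hfun]; exact h
  · intro s h0 h1
    have hs : 0 < 1 - s := by linarith
    obtain ⟨D, hD, hDlim⟩ := exists_L (fun n => (Qs p n)⁻¹) B hB (fun n => inv_pos.mpr (Qpos n))
      (fun a b hab => (inv_lt_inv₀ (Qpos a) (Qpos b)).mpr (Qanti hab)) Qinc s h0 h1
    have d1 : Tendsto (fun n => (D (k n) : ℝ) / ψ n) atTop (𝓝 (s / (1 - s))) := by
      have := (hDlim.comp hkinf).mul hkψ
      rw [mul_one] at this
      refine this.congr' ?_
      filter_upwards [hkinf.eventually_gt_atTop 0] with n hn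
      have hk' : (0:ℝ) < k n := by exact_mod_cast hn
      simp only [Function.comp]
      field_simp
    have d2 : Tendsto (fun n => ((D (k n) + 1 : ℕ) : ℝ) / ψ n) atTop (𝓝 (s / (1 - s))) := by
      have := d1.add (tendsto_const_nhds.div_atTop hψ : Tendsto (fun n => 1 / ψ n) atTop (𝓝 0))
      rw [add_zero] at this
      refine this.congr fun n => ?_
      push_cast; ring
    have l1 := (diff_lim (Qs p) B hB Qpos Qinc ψ hψ hψo _ _ d1).div_const s
    have l2 := (diff_lim (Qs p) B hB Qpos Qinc ψ hψ hψo _ _ d2).div_const s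
    have e : s / (1 - s) / s = 1 / (1 - s) := by field_simp
    rw [e] at l1 l2
    have mid : ∀ n, k n ≤ n → 1 - Qs p (n + D (k n)) ≤ pgfIter p (n - k n) (1 - (1 - s) * Qs p (k n)) ∧
        pgfIter p (n - k n) (1 - (1 - s) * Qs p (k n)) ≤ 1 - Qs p (n + (D (k n) + 1)) := by
      intro n hn
      have q1 := Qpos (k n)
      have q2 := Qle (k n)
      obtain ⟨g1, g2⟩ := hD (k n)
      have g1' : (1 - s) * Qs p (k n) ≤ Qs p (k n + D (k n)) := by
        have := Qpos (k n + D (k n))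
        rw [inv_eq_one_div, inv_eq_one_div, div_div, div_le_div_iff₀ (by positivity) (by positivity)] at g1
        linarith
      have g2' : Qs p (k n + D (k n) + 1) ≤ (1 - s) * Qs p (k n) := by
        have := Qpos (k n + D (k n) + 1)
        rw [inv_eq_one_div, inv_eq_one_div, div_div, div_lt_div_iff₀ (by positivity) (by positivity)] at g2
        linarith
      have f1 : n + D (k n) = (n - k n) + (k n + D (k n)) := by omega
      have f2 : n + (D (k n) + 1) = (n - k n) + (k n + D (k n) + 1) := by omega
      constructor
      · rw [f1]
        simp only [Qs, sub_sub_cancel] at *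
        rw [iter_add]
        have := iter_mem p hp0 hp1 (k n + D (k n)) 0 (by simp)
        refine iter_mono p hp0 hp1 _ _ _ this.1 (by linarith) ?_
        nlinarith
      · rw [f2]
        simp only [Qs, sub_sub_cancel] at *
        rw [iter_add]
        have := iter_mem p hp0 hp1 (k n + D (k n) + 1) 0 (by simp)
        refine iter_mono p hp0 hp1 _ _ _ ?_ (by linarith) this.2
        nlinarith
    refine tendsto_of_tendsto_of_tendsto_of_le_of_le' l1 l2 ?_ ?_
    · filter_upwards [hkn, hψ0] with n hn hψn
      have := (mid n hn).1
      refine div_le_div_of_nonneg_right (mul_le_mul_of_nonneg_left ?_ (by positivity)) h0.le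
      linarith
    · filter_upwards [hkn, hψ0] with n hn hψn
      have := (mid n hn).2
      refine div_le_div_of_nonneg_right (mul_le_mul_of_nonneg_left ?_ (by positivity)) h0.le
      linarith
end
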